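/- Assume Case [N2] with ρ = Υ and β = ϖ1 = ϖ2 = −(λτ)^{1/(τ+1)}. Then every positive solution u of equation (E) in Ω∖{0} satisfies |x|^{ϖ1} |log|x||^{2/(q−1)} u(x) → ( 2(q+τ)/(q−1)² )^{1/(q−1)} as |x| → 0. -/

import Mathlib

open MeasureTheory Filter Topology Real RealInnerProductSpace

noncomputable section

/-- The gradient factor `G_τ(x,z,ξ) = z^τ ‖ξ‖^(1-τ) / ‖x‖^(τ+1)`.
For `τ = 0` this equals `‖ξ‖ / ‖x‖`, since `z ^ (0:ℝ) = 1` for real powers. -/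
def Gt {N : ℕ} (τ : ℝ) (x : EuclideanSpace ℝ (Fin N)) (z : ℝ)
    (ξ : EuclideanSpace ℝ (Fin N)) : ℝ :=
  z ^ τ * ‖ξ‖ ^ (1 - τ) / ‖x‖ ^ (τ + 1)

/-- Test functions: `C¹` functions with compact support contained in `Ω \ {0}`. -/
def IsTestFun {N : ℕ} (Ω : Set (EuclideanSpace ℝ (Fin N)))
    (φ : EuclideanSpace ℝ (Fin N) → ℝ) : Prop :=
  ContDiff ℝ 1 φ ∧ HasCompactSupport φ ∧ tsupport φ ⊆ Ω \ {0}

/-- The distributional pairing of equation (E) with a test function `φ`: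
`∫ ∇u·∇φ + (N-2+2ρ) ∫ ((x·∇u)/|x|²) φ - λ ∫ G_τ(x,u,∇u) φ + ∫ |x|^θ u^q φ`. -/
def weakE (N : ℕ) (ρ lam τ θ q : ℝ) (Ω : Set (EuclideanSpace ℝ (Fin N)))
    (u φ : EuclideanSpace ℝ (Fin N) → ℝ) : ℝ :=
  (∫ x in Ω \ {0}, ⟪gradient u x, gradient φ x⟫)
    + ((N : ℝ) - 2 + 2 * ρ) * (∫ x in Ω \ {0}, ⟪x, gradient u x⟫ / ‖x‖ ^ 2 * φ x)
    - lam * (∫ x in Ω \ {0}, Gt τ x (u x) (gradient u x) * φ x)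
    + ∫ x in Ω \ {0}, ‖x‖ ^ θ * u x ^ q * φ x

/-- A positive `C¹` function on `Ω \ {0}`. -/
def PosC1 {N : ℕ} (Ω : Set (EuclideanSpace ℝ (Fin N)))
    (u : EuclideanSpace ℝ (Fin N) → ℝ) : Prop :=
  ContDiffOn ℝ 1 u (Ω \ {0}) ∧ ∀ x ∈ Ω \ {0}, 0 < u x

/-- Positive distributional solution of equation (E) in `Ω \ {0}`. -/
def IsSolutionE (N : ℕ) (ρ lam τ θ q : ℝ) (Ω : Set (EuclideanSpace ℝ (Fin N)))
    (u : EuclideanSpace ℝ (Fin N) → ℝ) : Prop :=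
  PosC1 Ω u ∧ ∀ φ, IsTestFun Ω φ → weakE N ρ lam τ θ q Ω u φ = 0

/-- Positive sub-solution of equation (E) in `Ω \ {0}`. -/
def IsSubSolutionE (N : ℕ) (ρ lam τ θ q : ℝ) (Ω : Set (EuclideanSpace ℝ (Fin N)))
    (u : EuclideanSpace ℝ (Fin N) → ℝ) : Prop :=
  PosC1 Ω u ∧ ∀ φ, IsTestFun Ω φ → (∀ x, 0 ≤ φ x) → weakE N ρ lam τ θ q Ω u φ ≤ 0

/-- Positive super-solution of equation (E) in `Ω \ {0}`. -/
def IsSuperSolutionE (N : ℕ) (ρ lam τ θ q : ℝ) (Ω : Set (EuclideanSpace ℝ (Fin N)))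
    (u : EuclideanSpace ℝ (Fin N) → ℝ) : Prop :=
  PosC1 Ω u ∧ ∀ φ, IsTestFun Ω φ → (∀ x, 0 ≤ φ x) → 0 ≤ weakE N ρ lam τ θ q Ω u φ

/-- `f_ρ(t) = t (t + 2ρ) + λ |t|^(1-τ)`. -/
def fRho (ρ lam τ t : ℝ) : ℝ := t * (t + 2 * ρ) + lam * |t| ^ (1 - τ)

/-- `Υ = ((τ+1)/(2τ)) (λτ)^(1/(τ+1))`. -/
def Upsilon (lam τ : ℝ) : ℝ := ((τ + 1) / (2 * τ)) * (lam * τ) ^ (1 / (τ + 1))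

/-- Case [N₀]: (a) `τ = 0` and `λ ≥ 2ρ`, or (b) `λ > 0`, `τ ∈ (0,1)` and `ρ < Υ`. -/
def CaseN0 (ρ lam τ : ℝ) : Prop :=
  (τ = 0 ∧ 2 * ρ ≤ lam) ∨ (0 < lam ∧ 0 < τ ∧ τ < 1 ∧ ρ < Upsilon lam τ)

/-- Case [N₁]: (a) `τ = 0` and `λ < 2ρ`, or (b) `λ < 0` and `τ ∈ (0,1)`. -/
def CaseN1 (ρ lam τ : ℝ) : Prop :=
  (τ = 0 ∧ lam < 2 * ρ) ∨ (lam < 0 ∧ 0 < τ ∧ τ < 1)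

/-- Case [N₂]: `λ > 0`, `τ ∈ (0,1)` and `ρ ≥ Υ`. -/
def CaseN2 (ρ lam τ : ℝ) : Prop :=
  0 < lam ∧ 0 < τ ∧ τ < 1 ∧ Upsilon lam τ ≤ ρ

/-- `w` is the smallest negative root of `f_ρ` (i.e. `w = ϖ₁`). -/
def IsMinNegRoot (ρ lam τ w : ℝ) : Prop :=
  w < 0 ∧ fRho ρ lam τ w = 0 ∧ ∀ t, t < 0 → fRho ρ lam τ t = 0 → w ≤ t

/-- `w` is the largest negative root of `f_ρ` (i.e. `w = ϖ₂`). -/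
def IsMaxNegRoot (ρ lam τ w : ℝ) : Prop :=
  w < 0 ∧ fRho ρ lam τ w = 0 ∧ ∀ t, t < 0 → fRho ρ lam τ t = 0 → t ≤ w

/-- `Φ_{ϖ₂}(r)`: equal to `r^(-ϖ₂)` if `ρ > Υ` and to `r^(-ϖ₂) |log r|^(2/(1+τ))` if `ρ = Υ`. -/
def Phi2 (ρ lam τ w2 r : ℝ) : ℝ :=
  if ρ = Upsilon lam τ then r ^ (-w2) * |Real.log r| ^ (2 / (1 + τ)) else r ^ (-w2)

/-- `Ψ_{ϖ₁}(t)`: equal to `t^(-ϖ₁)` if `ρ > Υ` and to `t^(-ϖ₁) (log t)^(2/(1+τ))` if `ρ = Υ`. -/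
def Psi1 (ρ lam τ w1 t : ℝ) : ℝ :=
  if ρ = Upsilon lam τ then t ^ (-w1) * (Real.log t) ^ (2 / (1 + τ)) else t ^ (-w1)

/-- The radial operator `L_{ρ,λ,τ}[P](r) = P'' + (1-2ρ) P'/r + λ P^τ |P'|^(1-τ)/r^(1+τ)`. -/
def Lrad (ρ lam τ : ℝ) (P : ℝ → ℝ) (r : ℝ) : ℝ :=
  deriv (deriv P) r + (1 - 2 * ρ) * deriv P r / r
    + lam * P r ^ τ * |deriv P r| ^ (1 - τ) / r ^ (1 + τ)

/-- The Laplacian of `u` at `x`, as the trace of the second derivative. -/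
def lapl {N : ℕ} (u : EuclideanSpace ℝ (Fin N) → ℝ) (x : EuclideanSpace ℝ (Fin N)) : ℝ :=
  ∑ i : Fin N, iteratedFDeriv ℝ 2 u x ![EuclideanSpace.single i 1, EuclideanSpace.single i 1]

/-- The divergence of a vector field on Euclidean space. -/
def fieldDiv {N : ℕ} (X : EuclideanSpace ℝ (Fin N) → EuclideanSpace ℝ (Fin N))
    (x : EuclideanSpace ℝ (Fin N)) : ℝ :=
  ∑ i : Fin N, fderiv ℝ X x (EuclideanSpace.single i 1) i

/-- A function continuous on an open set times a continuous function supported there is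
continuous. -/
lemma continuous_mul_of_tsupport_subset {E : Type*} [TopologicalSpace E] {V : Set E}
    (hV : IsOpen V) {F φ : E → ℝ} (hF : ContinuousOn F V) (hφ : Continuous φ)
    (hs : tsupport φ ⊆ V) : Continuous fun x => F x * φ x := by
  rw [continuous_iff_continuousAt]
  intro x
  by_cases hx : x ∈ V
  · exact (hF.continuousAt (hV.mem_nhds hx)).mul hφ.continuousAt
  · have hx' : x ∉ tsupport φ := fun h => hx (hs h)
    have h0 : (fun y => F y * φ y) =ᶠ[𝓝 x] fun _ => 0 := by
      filter_upwards [notMem_tsupport_iff_eventuallyEq.1 hx'] with y hy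
      simp [hy]
    exact continuousAt_const.congr h0.symm

lemma integrable_mul_of_tsupport_subset {N : ℕ} {V : Set (EuclideanSpace ℝ (Fin N))}
    (hV : IsOpen V) {F φ : EuclideanSpace ℝ (Fin N) → ℝ} (hF : ContinuousOn F V)
    (hφ : Continuous φ) (hc : HasCompactSupport φ) (hs : tsupport φ ⊆ V) :
    Integrable fun x => F x * φ x :=
  (continuous_mul_of_tsupport_subset hV hF hφ hs).integrable_of_hasCompactSupport hc.mul_left

lemma inner_gradient_eq_sum {N : ℕ} (v : EuclideanSpace ℝ (Fin N))
    (φ : EuclideanSpace ℝ (Fin N) → ℝ) (x : EuclideanSpace ℝ (Fin N)) :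
    ⟪v, gradient φ x⟫ = ∑ i, v i * fderiv ℝ φ x (EuclideanSpace.single i 1) := by
  rw [inner_gradient_right]
  conv_lhs => rw [← (EuclideanSpace.basisFun (Fin N) ℝ).sum_repr v]
  simp [map_sum]

lemma continuous_fderiv_apply_of_contDiff {N : ℕ} {φ : EuclideanSpace ℝ (Fin N) → ℝ}
    (hφ : ContDiff ℝ 1 φ) (v : EuclideanSpace ℝ (Fin N)) :
    Continuous fun x => fderiv ℝ φ x v :=
  (hφ.continuous_fderiv one_ne_zero).clm_apply continuous_const

lemma tsupport_fderiv_apply_subset' {N : ℕ} (φ : EuclideanSpace ℝ (Fin N) → ℝ)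
    (v : EuclideanSpace ℝ (Fin N)) : tsupport (fun x => fderiv ℝ φ x v) ⊆ tsupport φ :=
  tsupport_fderiv_apply_subset ℝ v

lemma hasCompactSupport_fderiv_apply {N : ℕ} {φ : EuclideanSpace ℝ (Fin N) → ℝ}
    (hc : HasCompactSupport φ) (v : EuclideanSpace ℝ (Fin N)) :
    HasCompactSupport fun x => fderiv ℝ φ x v :=
  hc.fderiv_apply ℝ v

lemma continuousOn_coord {N : ℕ} {V : Set (EuclideanSpace ℝ (Fin N))}
    {X : EuclideanSpace ℝ (Fin N) → EuclideanSpace ℝ (Fin N)} (hX : ContinuousOn X V)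
    (i : Fin N) : ContinuousOn (fun x => X x i) V :=
  (EuclideanSpace.proj (𝕜 := ℝ) i).continuous.comp_continuousOn hX

lemma integrable_inner_gradient {N : ℕ} {V : Set (EuclideanSpace ℝ (Fin N))}
    (hV : IsOpen V) {X : EuclideanSpace ℝ (Fin N) → EuclideanSpace ℝ (Fin N)}
    (hX : ContinuousOn X V) {φ : EuclideanSpace ℝ (Fin N) → ℝ} (hφ : ContDiff ℝ 1 φ)
    (hc : HasCompactSupport φ) (hs : tsupport φ ⊆ V) :
    Integrable fun x => ⟪X x, gradient φ x⟫ := by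
  simp_rw [inner_gradient_eq_sum]
  refine integrable_finsetSum _ fun i _ => ?_
  exact integrable_mul_of_tsupport_subset hV (continuousOn_coord hX i)
    (continuous_fderiv_apply_of_contDiff hφ _) (hasCompactSupport_fderiv_apply hc _)
    ((tsupport_fderiv_apply_subset' φ _).trans hs)

lemma continuousOn_fieldDiv {N : ℕ} {V : Set (EuclideanSpace ℝ (Fin N))}
    (hV : IsOpen V) {X : EuclideanSpace ℝ (Fin N) → EuclideanSpace ℝ (Fin N)}
    (hX : ContDiffOn ℝ 1 X V) : ContinuousOn (fieldDiv X) V := by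
  unfold fieldDiv
  refine continuousOn_finsetSum _ fun i _ => ?_
  exact continuousOn_coord
    ((hX.continuousOn_fderiv_of_isOpen hV le_rfl).clm_apply continuousOn_const) i

/-- Divergence theorem against a compactly supported `C¹` function. -/
lemma integral_inner_gradient_eq_neg_fieldDiv {N : ℕ} {V : Set (EuclideanSpace ℝ (Fin N))}
    (hV : IsOpen V) {X : EuclideanSpace ℝ (Fin N) → EuclideanSpace ℝ (Fin N)}
    (hX : ContDiffOn ℝ 1 X V) {φ : EuclideanSpace ℝ (Fin N) → ℝ} (hφ : ContDiff ℝ 1 φ)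
    (hc : HasCompactSupport φ) (hs : tsupport φ ⊆ V) :
    ∫ x, ⟪X x, gradient φ x⟫ = -∫ x, fieldDiv X x * φ x := by
  have hcoord : ∀ x ∈ V, ∀ i, HasFDerivAt (fun y => X y i)
      ((EuclideanSpace.proj (𝕜 := ℝ) i).comp (fderiv ℝ X x)) x := fun x hx i =>
    (EuclideanSpace.proj (𝕜 := ℝ) i).hasFDerivAt.comp x
      (((hX.differentiableOn one_ne_zero).differentiableAt (hV.mem_nhds hx)).hasFDerivAt)
  have hXd : ContinuousOn (fderiv ℝ X) V := hX.continuousOn_fderiv_of_isOpen hV le_rfl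
  have hint1 : ∀ i, Integrable fun x =>
      X x i * fderiv ℝ φ x (EuclideanSpace.single i 1) := fun i =>
    integrable_mul_of_tsupport_subset hV (continuousOn_coord hX.continuousOn i)
      (continuous_fderiv_apply_of_contDiff hφ _) (hasCompactSupport_fderiv_apply hc _)
      ((tsupport_fderiv_apply_subset' φ _).trans hs)
  have hint2 : ∀ i, Integrable fun x =>
      fderiv ℝ X x (EuclideanSpace.single i 1) i * φ x := fun i =>
    integrable_mul_of_tsupport_subset hV
      (continuousOn_coord (hXd.clm_apply continuousOn_const) i) hφ.continuous hc hs
  simp_rw [inner_gradient_eq_sum, fieldDiv, Finset.sum_mul]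
  rw [integral_finsetSum _ fun i _ => hint1 i, integral_finsetSum _ fun i _ => hint2 i,
    ← Finset.sum_neg_distrib]
  refine Finset.sum_congr rfl fun i _ => ?_
  have key := integral_bilinear_hasFDerivAt_right_eq_neg_left_of_integrable
    (μ := (volume : Measure (EuclideanSpace ℝ (Fin N))))
    (f := fun x => X x i)
    (f' := fun x => (EuclideanSpace.proj (𝕜 := ℝ) i).comp (fderiv ℝ X x))
    (g := φ) (g' := fderiv ℝ φ) (v := EuclideanSpace.single i 1)
    (B := ContinuousLinearMap.mul ℝ ℝ)
    (by simpa using hint2 i) (by simpa using hint1 i)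
    (by simpa using integrable_mul_of_tsupport_subset hV
          (continuousOn_coord hX.continuousOn i) hφ.continuous hc hs)
    (fun x hx => hcoord x (hs hx) i)
    (fun x _ => (hφ.differentiable one_ne_zero x).hasFDerivAt)
  simpa using key

lemma hasDerivAt_max_zero_sq (s : ℝ) : HasDerivAt (fun s : ℝ => max s 0 ^ 2) (2 * max s 0) s := by
  rcases lt_trichotomy s 0 with h | rfl | h
  · have : (fun s : ℝ => max s 0 ^ 2) =ᶠ[𝓝 s] fun _ => 0 := by
      filter_upwards [gt_mem_nhds h] with y hy
      simp [max_eq_right hy.le]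
    rw [max_eq_right h.le, mul_zero]
    exact (hasDerivAt_const s (0 : ℝ)).congr_of_eventuallyEq this
  · rw [hasDerivAt_iff_isLittleO]
    simp only [max_self, ne_eq, OfNat.ofNat_ne_zero, not_false_eq_true, zero_pow, sub_zero,
      mul_zero, smul_zero]
    have h1 : (fun x : ℝ => max x 0 ^ 2) =O[𝓝 0] fun x : ℝ => x ^ 2 := by
      refine Asymptotics.IsBigO.of_bound 1 (Eventually.of_forall fun x => ?_)
      rw [one_mul, Real.norm_eq_abs, Real.norm_eq_abs, abs_of_nonneg (sq_nonneg _),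
        abs_of_nonneg (sq_nonneg _)]
      rcases le_total x 0 with hx | hx
      · rw [max_eq_right hx, zero_pow two_ne_zero]; positivity
      · rw [max_eq_left hx]
    refine h1.trans_isLittleO ?_
    simpa using Asymptotics.isLittleO_pow_id (𝕜 := ℝ) one_lt_two
  · have : (fun s : ℝ => max s 0 ^ 2) =ᶠ[𝓝 s] fun s => s ^ 2 := by
      filter_upwards [lt_mem_nhds h] with y hy
      simp [max_eq_left hy.le]
    rw [max_eq_left h.le]
    simpa using (hasDerivAt_pow 2 s).congr_of_eventuallyEq this

lemma contDiff_max_zero_sq : ContDiff ℝ 1 fun s : ℝ => max s 0 ^ 2 := by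
  rw [contDiff_one_iff_deriv]
  refine ⟨fun s => (hasDerivAt_max_zero_sq s).differentiableAt, ?_⟩
  rw [funext fun s => (hasDerivAt_max_zero_sq s).deriv]
  fun_prop

/-- A `C¹` function whose distributional Laplacian is negative near a point cannot have a
quadratically strict local maximum there with the opposite sign convention: if
`∫ ∇w·∇φ = ∫ G φ` with `G < 0`, there is no strict interior maximum. -/
lemma no_strict_max_of_weak {N : ℕ} {x₀ : EuclideanSpace ℝ (Fin N)} {r ε : ℝ} (hr : 0 < r)
    (hε : 0 < ε) {w G : EuclideanSpace ℝ (Fin N) → ℝ}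
    (hw : ContDiffOn ℝ 1 w (Metric.ball x₀ r)) (hG : ContinuousOn G (Metric.ball x₀ r))
    (hneg : ∀ x ∈ Metric.ball x₀ r, G x < 0)
    (hmax : ∀ x ∈ Metric.ball x₀ r, w x ≤ w x₀ - ε * ‖x - x₀‖ ^ 2)
    (hweak : ∀ φ : EuclideanSpace ℝ (Fin N) → ℝ, ContDiff ℝ 1 φ → HasCompactSupport φ →
      tsupport φ ⊆ Metric.ball x₀ r →
      ∫ x, ⟪gradient w x, gradient φ x⟫ = ∫ x, G x * φ x) : False := by
  set B := Metric.ball x₀ r with hB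
  have hx₀ : x₀ ∈ B := Metric.mem_ball_self hr
  set η : ℝ := ε * (r / 2) ^ 2 with hη
  have hηpos : 0 < η := by positivity
  set ψ : EuclideanSpace ℝ (Fin N) → ℝ := fun x => max (w x - w x₀ + η) 0 ^ 2 with hψ
  set φ : EuclideanSpace ℝ (Fin N) → ℝ := B.indicator ψ with hφ
  have hsupp : Function.support φ ⊆ Metric.closedBall x₀ (r / 2) := by
    intro x hx
    by_contra hxr
    rw [Metric.mem_closedBall, not_le, dist_eq_norm] at hxr
    apply hx
    by_cases hxB : x ∈ B
    · have h1 := hmax x hxB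
      have h2 : (r / 2) ^ 2 ≤ ‖x - x₀‖ ^ 2 := by gcongr
      have h3 : w x - w x₀ + η ≤ 0 := by
        rw [hη]
        nlinarith [mul_le_mul_of_nonneg_left h2 hε.le]
      simp [hφ, hψ, hxB, max_eq_right h3]
    · simp [hφ, hxB]
  have htsupp : tsupport φ ⊆ Metric.closedBall x₀ (r / 2) :=
    closure_minimal hsupp Metric.isClosed_closedBall
  have hsub : tsupport φ ⊆ B :=
    htsupp.trans (Metric.closedBall_subset_ball (by linarith))
  have hcs : HasCompactSupport φ :=
    (isCompact_closedBall x₀ (r / 2)).of_isClosed_subset (isClosed_tsupport φ) htsupp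
  have hEq : ∀ x ∈ B, φ =ᶠ[𝓝 x] ψ := fun x hx => by
    filter_upwards [Metric.isOpen_ball.mem_nhds hx] with y hy
    exact Set.indicator_of_mem hy ψ
  have hwat : ∀ x ∈ B, ContDiffAt ℝ 1 w x := fun x hx =>
    hw.contDiffAt (Metric.isOpen_ball.mem_nhds hx)
  have hC1 : ContDiff ℝ 1 φ := by
    rw [contDiff_iff_contDiffAt]
    intro x
    by_cases hx : x ∈ B
    · refine ContDiffAt.congr_of_eventuallyEq ?_ (hEq x hx)
      exact contDiff_max_zero_sq.contDiffAt.comp x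
        (((hwat x hx).sub contDiffAt_const).add contDiffAt_const)
    · have hx' : x ∉ tsupport φ := fun h => hx (hsub h)
      exact contDiffAt_const.congr_of_eventuallyEq (notMem_tsupport_iff_eventuallyEq.1 hx')
  have hgrad : ∀ x, 0 ≤ ⟪gradient w x, gradient φ x⟫ := by
    intro x
    by_cases hx : x ∈ B
    · have hd : HasFDerivAt w (fderiv ℝ w x) x :=
        ((hwat x hx).differentiableAt one_ne_zero).hasFDerivAt
      have hd2 : HasFDerivAt ψ ((2 * max (w x - w x₀ + η) 0) • fderiv ℝ w x) x :=
        HasDerivAt.comp_hasFDerivAt (h₂ := fun s : ℝ => max s 0 ^ 2) x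
          (hasDerivAt_max_zero_sq (w x - w x₀ + η)) ((hd.sub_const (w x₀)).add_const η)
      rw [inner_gradient_right, (hEq x hx).fderiv_eq, hd2.fderiv]
      have : fderiv ℝ w x (gradient w x) = ‖gradient w x‖ ^ 2 := by
        rw [← inner_gradient_left, real_inner_self_eq_norm_sq]
      simp only [smul_apply, this, smul_eq_mul, conj_trivial]
      positivity
    · have hx' : x ∉ tsupport φ := fun h => hx (hsub h)
      have : fderiv ℝ φ x = 0 := by
        rw [(notMem_tsupport_iff_eventuallyEq.1 hx').fderiv_eq]; simp
      rw [inner_gradient_right, this]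
      simp
  have hφ0 : ∀ x, 0 ≤ φ x := fun x => Set.indicator_nonneg (fun y _ => sq_nonneg _) x
  have hpos : 0 < ∫ x, -(G x * φ x) := by
    refine Continuous.integral_pos_of_hasCompactSupport_nonneg_nonzero (x := x₀)
      (continuous_mul_of_tsupport_subset Metric.isOpen_ball hG hC1.continuous hsub).neg
      (hcs.mul_left (f := G)).neg ?_ ?_
    · intro x
      by_cases hx : x ∈ B
      · have := mul_nonneg (neg_nonneg.2 (hneg x hx).le) (hφ0 x)
        simpa using this
      · simp [hφ, hx]
    · have h1 : φ x₀ = η ^ 2 := by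
        simp [hφ, hx₀, hψ, max_eq_left hηpos.le]
      rw [h1]
      have := (hneg x₀ hx₀).ne
      simp [this, hηpos.ne']
  rw [integral_neg, ← hweak φ hC1 hcs hsub] at hpos
  have := integral_nonneg (μ := volume) (f := fun x => ⟪gradient w x, gradient φ x⟫) hgrad
  linarith

/-- Weak `C¹` solutions of `Δu + g = 0` are viscosity subsolutions: a `C²` function touching `u`
from above (here `X = ∇P`) satisfies the differential inequality at the contact point. -/
lemma fieldDiv_add_nonneg_of_isLocalMax {N : ℕ} {U : Set (EuclideanSpace ℝ (Fin N))}
    (hU : IsOpen U) {u g P : EuclideanSpace ℝ (Fin N) → ℝ}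
    {X : EuclideanSpace ℝ (Fin N) → EuclideanSpace ℝ (Fin N)}
    (hu : ContDiffOn ℝ 1 u U) (hg : ContinuousOn g U)
    (hweak : ∀ φ : EuclideanSpace ℝ (Fin N) → ℝ, ContDiff ℝ 1 φ → HasCompactSupport φ →
      tsupport φ ⊆ U → ∫ x, ⟪gradient u x, gradient φ x⟫ = ∫ x, g x * φ x)
    {x₀ : EuclideanSpace ℝ (Fin N)} (hx₀ : x₀ ∈ U)
    (hP : ∀ᶠ x in 𝓝 x₀, HasGradientAt P (X x) x) (hX : ContDiffAt ℝ 1 X x₀)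
    (hmax : IsLocalMax (fun x => u x - P x) x₀) : 0 ≤ fieldDiv X x₀ + g x₀ := by
  by_contra hcon
  rw [not_le] at hcon
  obtain ⟨V, hVnhds, hXV⟩ := hX.contDiffOn le_rfl (by simp)
  obtain ⟨V', hV'V, hV'o, hxV'⟩ := mem_nhds_iff.1 hVnhds
  have hXV' : ContDiffOn ℝ 1 X V' := hXV.mono hV'V
  set c := -(fieldDiv X x₀ + g x₀) with hc
  have hcpos : 0 < c := by linarith
  set ε := c / (4 * (N + 1)) with hε
  have hεpos : 0 < ε := by positivity
  have hεN : 2 * N * ε < c := by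
    have h1 : ε * (4 * (N + 1)) = c := by rw [hε]; field_simp
    nlinarith
  have hcont : ContinuousAt (fun x => fieldDiv X x + g x) x₀ :=
    ((continuousOn_fieldDiv hV'o hXV').continuousAt (hV'o.mem_nhds hxV')).add
      (hg.continuousAt (hU.mem_nhds hx₀))
  have hev1 : ∀ᶠ x in 𝓝 x₀, fieldDiv X x + g x < -(2 * N * ε) :=
    hcont.eventually_lt_const (by linarith)
  have hev := hev1.and (hP.and (hmax.and ((hV'o.eventually_mem hxV').and (hU.eventually_mem hx₀))))
  obtain ⟨r, hr, hball⟩ := Metric.eventually_nhds_iff_ball.1 hev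
  set Y : EuclideanSpace ℝ (Fin N) → EuclideanSpace ℝ (Fin N) :=
    fun x => X x + (2 * ε) • (x - x₀) with hY
  have hYC : ContDiffOn ℝ 1 Y (Metric.ball x₀ r) :=
    (hXV'.mono fun x hx => (hball x hx).2.2.2.1).add (by fun_prop)
  have hYdiv : ∀ x ∈ Metric.ball x₀ r, fieldDiv Y x = fieldDiv X x + 2 * N * ε := by
    intro x hx
    have hd : HasFDerivAt Y (fderiv ℝ X x + (2 * ε) • ContinuousLinearMap.id ℝ _) x :=
      (((hXV'.differentiableOn one_ne_zero).differentiableAt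
        (hV'o.mem_nhds (hball x hx).2.2.2.1)).hasFDerivAt).add
        (((hasFDerivAt_id x).sub_const x₀).const_smul (2 * ε))
    simp only [fieldDiv, hd.fderiv]
    simp [Finset.sum_add_distrib]
    ring
  have hYgrad : ∀ x ∈ Metric.ball x₀ r,
      HasGradientAt (fun x => P x + ε * ‖x - x₀‖ ^ 2) (Y x) x := by
    intro x hx
    rw [hasGradientAt_iff_hasFDerivAt]
    have h1 := (hball x hx).2.1.hasFDerivAt
    have h2 := (((hasFDerivAt_id x).sub_const x₀).norm_sq).const_mul ε
    refine (h1.add h2).congr_fderiv ?_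
    ext v
    simp [hY]
    ring
  set w : EuclideanSpace ℝ (Fin N) → ℝ := fun x => u x - (P x + ε * ‖x - x₀‖ ^ 2) with hw
  have hugrad : ∀ x ∈ Metric.ball x₀ r, HasGradientAt u (gradient u x) x := fun x hx =>
    ((hu.differentiableOn one_ne_zero).differentiableAt
      (hU.mem_nhds (hball x hx).2.2.2.2)).hasGradientAt
  have hwgrad : ∀ x ∈ Metric.ball x₀ r, HasGradientAt w (gradient u x - Y x) x := by
    intro x hx
    rw [hasGradientAt_iff_hasFDerivAt, map_sub]
    exact (hugrad x hx).hasFDerivAt.sub (hYgrad x hx).hasFDerivAt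
  have hgu : ContinuousOn (gradient u) U :=
    (InnerProductSpace.toDual ℝ _).symm.continuous.comp_continuousOn
      (hu.continuousOn_fderiv_of_isOpen hU le_rfl)
  have hballU : Metric.ball x₀ r ⊆ U := fun x hx => (hball x hx).2.2.2.2
  have hwC : ContDiffOn ℝ 1 w (Metric.ball x₀ r) := by
    have h01 : (1 : WithTop ℕ∞) = 0 + 1 := by simp
    rw [h01, contDiffOn_succ_iff_fderiv_of_isOpen Metric.isOpen_ball]
    refine ⟨fun x hx => (hwgrad x hx).differentiableAt.differentiableWithinAt, by simp, ?_⟩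
    rw [contDiffOn_zero]
    refine ContinuousOn.congr ((InnerProductSpace.toDual ℝ _).continuous.comp_continuousOn
      ((hgu.mono hballU).sub hYC.continuousOn)) fun x hx => ?_
    exact (hwgrad x hx).hasFDerivAt.fderiv
  refine no_strict_max_of_weak (G := fun x => g x + fieldDiv Y x) hr hεpos hwC
    ((hg.mono hballU).add (continuousOn_fieldDiv Metric.isOpen_ball hYC)) ?_ ?_ ?_
  · intro x hx
    rw [hYdiv x hx]
    linarith [(hball x hx).1]
  · intro x hx
    have := (hball x hx).2.2.1
    simp only [hw, sub_self, norm_zero]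
    linarith
  · intro φ hφ hcφ hsφ
    have h1 : ∀ x, ⟪gradient w x, gradient φ x⟫
        = ⟪gradient u x, gradient φ x⟫ - ⟪Y x, gradient φ x⟫ := by
      intro x
      by_cases hx : x ∈ Metric.ball x₀ r
      · rw [(hwgrad x hx).gradient, inner_sub_left]
      · have hx' : x ∉ tsupport φ := fun h => hx (hsφ h)
        have : fderiv ℝ φ x = 0 := by
          rw [(notMem_tsupport_iff_eventuallyEq.1 hx').fderiv_eq]; simp
        simp [inner_gradient_right, this]
    simp_rw [h1]
    rw [integral_sub (integrable_inner_gradient hU hgu hφ hcφ (hsφ.trans hballU))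
      (integrable_inner_gradient Metric.isOpen_ball hYC.continuousOn hφ hcφ hsφ),
      integral_inner_gradient_eq_neg_fieldDiv Metric.isOpen_ball hYC hφ hcφ hsφ,
      hweak φ hφ hcφ (hsφ.trans hballU), sub_neg_eq_add, ← integral_add
        (integrable_mul_of_tsupport_subset hU hg hφ.continuous hcφ (hsφ.trans hballU))
        (integrable_mul_of_tsupport_subset Metric.isOpen_ball
          (continuousOn_fieldDiv Metric.isOpen_ball hYC) hφ.continuous hcφ hsφ)]
    simp_rw [add_mul]

lemma fieldDiv_neg {N : ℕ} (X : EuclideanSpace ℝ (Fin N) → EuclideanSpace ℝ (Fin N))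
    (x : EuclideanSpace ℝ (Fin N)) : fieldDiv (-X) x = -fieldDiv X x := by
  simp [fieldDiv, fderiv_neg]

lemma gradient_neg' {N : ℕ} (u : EuclideanSpace ℝ (Fin N) → ℝ)
    (x : EuclideanSpace ℝ (Fin N)) : gradient (-u) x = -gradient u x := by
  simp [gradient, fderiv_neg]

/-- Weak `C¹` solutions of `Δu + g = 0` are viscosity supersolutions. -/
lemma fieldDiv_add_nonpos_of_isLocalMin {N : ℕ} {U : Set (EuclideanSpace ℝ (Fin N))}
    (hU : IsOpen U) {u g P : EuclideanSpace ℝ (Fin N) → ℝ}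
    {X : EuclideanSpace ℝ (Fin N) → EuclideanSpace ℝ (Fin N)}
    (hu : ContDiffOn ℝ 1 u U) (hg : ContinuousOn g U)
    (hweak : ∀ φ : EuclideanSpace ℝ (Fin N) → ℝ, ContDiff ℝ 1 φ → HasCompactSupport φ →
      tsupport φ ⊆ U → ∫ x, ⟪gradient u x, gradient φ x⟫ = ∫ x, g x * φ x)
    {x₀ : EuclideanSpace ℝ (Fin N)} (hx₀ : x₀ ∈ U)
    (hP : ∀ᶠ x in 𝓝 x₀, HasGradientAt P (X x) x) (hX : ContDiffAt ℝ 1 X x₀)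
    (hmin : IsLocalMin (fun x => u x - P x) x₀) : fieldDiv X x₀ + g x₀ ≤ 0 := by
  have h := fieldDiv_add_nonneg_of_isLocalMax (u := -u) (g := -g) (P := -P) (X := -X) hU hu.neg
    hg.neg (fun φ hφ hc hs => by
      have := hweak φ hφ hc hs
      simp only [gradient_neg', inner_neg_left, Pi.neg_apply, neg_mul, integral_neg, this])
    hx₀ (hP.mono fun x hx => by
      rw [hasGradientAt_iff_hasFDerivAt, Pi.neg_apply, map_neg]
      exact hx.hasFDerivAt.neg) hX.neg (by
      have := hmin.neg
      refine this.congr (Eventually.of_forall fun x => ?_)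
      simp only [Pi.neg_apply]
      ring)
  rw [fieldDiv_neg, Pi.neg_apply] at h
  linarith

lemma hasFDerivAt_log_norm {N : ℕ} {x : EuclideanSpace ℝ (Fin N)} (hx : x ≠ 0) :
    HasFDerivAt (fun y : EuclideanSpace ℝ (Fin N) => Real.log ‖y‖)
      ((‖x‖ ^ 2)⁻¹ • innerSL ℝ x) x := by
  have hn : ‖x‖ ^ 2 ≠ 0 := by positivity
  have h1 := (((hasFDerivAt_id x).norm_sq).log hn).const_mul (1 / 2 : ℝ)
  have h2 : (fun y : EuclideanSpace ℝ (Fin N) => Real.log ‖y‖)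
      = fun y => 1 / 2 * Real.log (‖id y‖ ^ 2) := by
    ext y
    rw [Real.log_pow, id]
    push_cast
    ring
  rw [h2]
  refine h1.congr_fderiv ?_
  ext v
  simp
  ring

/-- The gradient field of the radial function `x ↦ p (log ‖x‖)`, with `p₁ = p'`. -/
def radialField {N : ℕ} (p₁ : ℝ → ℝ) (x : EuclideanSpace ℝ (Fin N)) :
    EuclideanSpace ℝ (Fin N) :=
  (p₁ (Real.log ‖x‖) * (‖x‖ ^ 2)⁻¹) • x

lemma hasGradientAt_radial {N : ℕ} {p p₁ : ℝ → ℝ} {x : EuclideanSpace ℝ (Fin N)} (hx : x ≠ 0)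
    (hp : HasDerivAt p (p₁ (Real.log ‖x‖)) (Real.log ‖x‖)) :
    HasGradientAt (fun y : EuclideanSpace ℝ (Fin N) => p (Real.log ‖y‖)) (radialField p₁ x) x := by
  rw [hasGradientAt_iff_hasFDerivAt]
  refine (HasDerivAt.comp_hasFDerivAt x hp (hasFDerivAt_log_norm hx)).congr_fderiv ?_
  ext v
  simp [radialField, mul_assoc]

lemma contDiffAt_radialField {N : ℕ} {p₁ : ℝ → ℝ} {x : EuclideanSpace ℝ (Fin N)} (hx : x ≠ 0)
    (hp : ContDiffAt ℝ 1 p₁ (Real.log ‖x‖)) :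
    ContDiffAt ℝ 1 (radialField p₁ : EuclideanSpace ℝ (Fin N) → _) x := by
  have hn : ‖x‖ ≠ 0 := norm_ne_zero_iff.2 hx
  have h1 : ContDiffAt ℝ 1 (fun y : EuclideanSpace ℝ (Fin N) => ‖y‖) x := contDiffAt_norm ℝ hx
  have h2 : ContDiffAt ℝ 1 (fun y : EuclideanSpace ℝ (Fin N) => Real.log ‖y‖) x := h1.log hn
  exact ((hp.comp x h2).mul ((h1.pow 2).inv (pow_ne_zero 2 hn))).smul contDiffAt_id

lemma fieldDiv_radialField {N : ℕ} {p₁ : ℝ → ℝ} {p₂ : ℝ} {x : EuclideanSpace ℝ (Fin N)}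
    (hx : x ≠ 0) (hp : HasDerivAt p₁ p₂ (Real.log ‖x‖)) :
    fieldDiv (radialField p₁) x
      = (p₂ + ((N : ℝ) - 2) * p₁ (Real.log ‖x‖)) / ‖x‖ ^ 2 := by
  have hn : ‖x‖ ≠ 0 := norm_ne_zero_iff.2 hx
  have h1 := HasDerivAt.comp_hasFDerivAt x hp (hasFDerivAt_log_norm hx)
  have h2 : HasFDerivAt (fun y : EuclideanSpace ℝ (Fin N) => (‖y‖ ^ 2)⁻¹)
      (-((‖x‖ ^ 2) ^ 2)⁻¹ • (2 : ℝ) • innerSL ℝ x) x :=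
    HasDerivAt.comp_hasFDerivAt x (hasDerivAt_inv (pow_ne_zero 2 hn))
      (((hasFDerivAt_id x).norm_sq).congr_fderiv (by ext v; simp))
  have h3 := (h1.mul h2).smul (hasFDerivAt_id x)
  have h4 : HasFDerivAt (radialField p₁ : EuclideanSpace ℝ (Fin N) → _) _ x := h3
  have hsum : ∑ i, x i * x i = ‖x‖ ^ 2 := by
    rw [EuclideanSpace.real_norm_sq_eq]
    exact Finset.sum_congr rfl fun i _ => by ring
  rw [fieldDiv, h4.fderiv]
  have : ∀ i : Fin N, ⟪x, EuclideanSpace.single i (1 : ℝ)⟫ = x i := fun i => by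
    simp [EuclideanSpace.inner_single_right]
  simp [this, Finset.sum_add_distrib]
  have e : ∀ i, (-(p₁ (log ‖x‖) * (((‖x‖ ^ 2) ^ 2)⁻¹ * (2 * x i)))
      + (‖x‖ ^ 2)⁻¹ * (p₂ * ((‖x‖ ^ 2)⁻¹ * x i))) * x i
      = (-(p₁ (log ‖x‖) * ((‖x‖ ^ 2) ^ 2)⁻¹ * 2) + (‖x‖ ^ 2)⁻¹ * p₂ * (‖x‖ ^ 2)⁻¹)
        * (x i * x i) := fun i => by ring
  simp_rw [e, ← Finset.mul_sum, hsum]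
  field_simp
  ring

/-- The lower order terms of equation (E), moved to the right-hand side. -/
def lowerE (N : ℕ) (ρ lam τ θ q : ℝ) (u : EuclideanSpace ℝ (Fin N) → ℝ)
    (x : EuclideanSpace ℝ (Fin N)) : ℝ :=
  lam * Gt τ x (u x) (gradient u x) - ((N : ℝ) - 2 + 2 * ρ) * (⟪x, gradient u x⟫ / ‖x‖ ^ 2)
    - ‖x‖ ^ θ * u x ^ q

lemma isOpen_punctured {N : ℕ} {Ω : Set (EuclideanSpace ℝ (Fin N))} (hΩ : IsOpen Ω) :
    IsOpen (Ω \ {0}) := hΩ.sdiff isClosed_singleton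

lemma continuousOn_gradient {N : ℕ} {U : Set (EuclideanSpace ℝ (Fin N))} (hU : IsOpen U)
    {u : EuclideanSpace ℝ (Fin N) → ℝ} (hu : ContDiffOn ℝ 1 u U) :
    ContinuousOn (gradient u) U :=
  (InnerProductSpace.toDual ℝ _).symm.continuous.comp_continuousOn
    (hu.continuousOn_fderiv_of_isOpen hU le_rfl)

section LowerOrder

variable {N : ℕ} {ρ lam τ θ q : ℝ} {Ω : Set (EuclideanSpace ℝ (Fin N))}
  {u : EuclideanSpace ℝ (Fin N) → ℝ}

lemma norm_ne_zero_of_mem_punctured {x : EuclideanSpace ℝ (Fin N)} (hx : x ∈ Ω \ {0}) :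
    ‖x‖ ≠ 0 := norm_ne_zero_iff.2 hx.2

lemma continuousOn_Gt (hΩ : IsOpen Ω) (hτ1 : τ < 1) (hu : PosC1 Ω u) :
    ContinuousOn (fun x => Gt τ x (u x) (gradient u x)) (Ω \ {0}) := by
  have hg := continuousOn_gradient (isOpen_punctured hΩ) hu.1
  refine ((hu.1.continuousOn.rpow_const fun x hx => Or.inl (hu.2 x hx).ne').mul
    (hg.norm.rpow_const fun _ _ => Or.inr (by linarith))).div
    (continuousOn_id.norm.rpow_const fun _ hx => Or.inl (norm_ne_zero_of_mem_punctured hx))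
    fun x hx => ?_
  exact (Real.rpow_pos_of_pos (norm_pos_iff.2 hx.2) _).ne'

lemma continuousOn_drift (hΩ : IsOpen Ω) (hu : PosC1 Ω u) :
    ContinuousOn (fun x => ⟪x, gradient u x⟫ / ‖x‖ ^ 2) (Ω \ {0}) :=
  (continuousOn_id.inner (continuousOn_gradient (isOpen_punctured hΩ) hu.1)).div
    (continuousOn_id.norm.pow 2) fun _ hx => pow_ne_zero 2 (norm_ne_zero_of_mem_punctured hx)

lemma continuousOn_absorption (hu : PosC1 Ω u) :
    ContinuousOn (fun x => ‖x‖ ^ θ * u x ^ q) (Ω \ {0}) :=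
  (continuousOn_id.norm.rpow_const fun _ hx => Or.inl (norm_ne_zero_of_mem_punctured hx)).mul
    (hu.1.continuousOn.rpow_const fun x hx => Or.inl (hu.2 x hx).ne')

lemma continuousOn_lowerE (hΩ : IsOpen Ω) (hτ1 : τ < 1) (hu : PosC1 Ω u) :
    ContinuousOn (lowerE N ρ lam τ θ q u) (Ω \ {0}) :=
  ((continuousOn_const.mul (continuousOn_Gt hΩ hτ1 hu)).sub
    (continuousOn_const.mul (continuousOn_drift hΩ hu))).sub (continuousOn_absorption hu)

lemma weak_identity_of_isSolutionE (hΩ : IsOpen Ω) (hτ1 : τ < 1)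
    (hu : IsSolutionE N ρ lam τ θ q Ω u) {φ : EuclideanSpace ℝ (Fin N) → ℝ}
    (hφ : ContDiff ℝ 1 φ) (hc : HasCompactSupport φ) (hs : tsupport φ ⊆ Ω \ {0}) :
    ∫ x, ⟪gradient u x, gradient φ x⟫ = ∫ x, lowerE N ρ lam τ θ q u x * φ x := by
  have h := hu.2 φ ⟨hφ, hc, hs⟩
  have hz : ∀ x, x ∉ Ω \ {0} → φ x = 0 := fun x hx =>
    image_eq_zero_of_notMem_tsupport fun h => hx (hs h)
  have hO := isOpen_punctured hΩ
  unfold weakE at h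
  rw [setIntegral_eq_integral_of_forall_compl_eq_zero (fun x hx => by
      have hx' : x ∉ tsupport φ := fun h => hx (hs h)
      have : fderiv ℝ φ x = 0 := by
        rw [(notMem_tsupport_iff_eventuallyEq.1 hx').fderiv_eq]; simp
      simp [inner_gradient_right, this]),
    setIntegral_eq_integral_of_forall_compl_eq_zero (fun x hx => by simp [hz x hx]),
    setIntegral_eq_integral_of_forall_compl_eq_zero (fun x hx => by simp [hz x hx]),
    setIntegral_eq_integral_of_forall_compl_eq_zero (fun x hx => by simp [hz x hx])] at h
  have i1 := integrable_mul_of_tsupport_subset hO (continuousOn_drift hΩ hu.1) hφ.continuous hc hs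
  have i2 := integrable_mul_of_tsupport_subset hO (continuousOn_Gt hΩ hτ1 hu.1) hφ.continuous hc hs
  have i3 := integrable_mul_of_tsupport_subset hO
    (continuousOn_absorption (θ := θ) (q := q) hu.1) hφ.continuous hc hs
  have e : (fun x => lowerE N ρ lam τ θ q u x * φ x) = fun x =>
      lam * (Gt τ x (u x) (gradient u x) * φ x)
        - ((N : ℝ) - 2 + 2 * ρ) * (⟪x, gradient u x⟫ / ‖x‖ ^ 2 * φ x)
        - ‖x‖ ^ θ * u x ^ q * φ x := by
    ext x
    simp only [lowerE]
    ring
  have i12 : Integrable fun x => lam * (Gt τ x (u x) (gradient u x) * φ x)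
      - ((N : ℝ) - 2 + 2 * ρ) * (⟪x, gradient u x⟫ / ‖x‖ ^ 2 * φ x) :=
    (i2.const_mul _).sub (i1.const_mul _)
  rw [e, integral_sub i12 i3,
    integral_sub (i2.const_mul _) (i1.const_mul _), integral_const_mul, integral_const_mul]
  linarith

/-- The value of the equation at a contact point with the radial function `exp (V (log ‖x‖))`. -/
lemma fieldDiv_add_lowerE_eq {x : EuclideanSpace ℝ (Fin N)} (hx : x ≠ 0)
    (hux : 0 < u x) {p₁ : ℝ → ℝ} {p₂ V₁ V₂ : ℝ} (hp : HasDerivAt p₁ p₂ (Real.log ‖x‖))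
    (hp₁ : p₁ (Real.log ‖x‖) = V₁ * u x) (hp₂ : p₂ = (V₂ + V₁ ^ 2) * u x)
    (hgrad : gradient u x = radialField p₁ x) :
    fieldDiv (radialField p₁) x + lowerE N ρ lam τ θ q u x
      = u x / ‖x‖ ^ 2 * (V₂ + V₁ ^ 2 - 2 * ρ * V₁ + lam * |V₁| ^ (1 - τ)
          - ‖x‖ ^ (θ + 2) * u x ^ (q - 1)) := by
  have hn : 0 < ‖x‖ := norm_pos_iff.2 hx
  have hinner : ⟪x, gradient u x⟫ = V₁ * u x := by
    rw [hgrad, radialField, inner_smul_right, real_inner_self_eq_norm_sq, hp₁]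
    field_simp
  have hnorm : ‖gradient u x‖ = |V₁| * u x / ‖x‖ := by
    rw [hgrad, radialField, norm_smul, hp₁, Real.norm_eq_abs, abs_mul, abs_mul, abs_of_pos hux,
      abs_of_pos (by positivity : 0 < (‖x‖ ^ 2)⁻¹)]
    field_simp
  have hG : Gt τ x (u x) (gradient u x) = u x * |V₁| ^ (1 - τ) / ‖x‖ ^ 2 := by
    rw [Gt, hnorm, Real.div_rpow (by positivity) hn.le, Real.mul_rpow (abs_nonneg _) hux.le]
    have e1 : u x ^ τ * u x ^ (1 - τ) = u x := by
      rw [← Real.rpow_add hux]; simp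
    have e2 : ‖x‖ ^ (1 - τ) * ‖x‖ ^ (τ + 1) = ‖x‖ ^ 2 := by
      rw [← Real.rpow_add hn, ← Real.rpow_natCast]
      congr 1
      push_cast
      ring
    rw [← e2]
    nth_rewrite 3 [← e1]
    field_simp
  have hpow : ‖x‖ ^ (θ + 2) = ‖x‖ ^ θ * ‖x‖ ^ 2 := by
    rw [Real.rpow_add hn, Real.rpow_two]
  have hpow2 : u x ^ q = u x ^ (q - 1) * u x := by
    nth_rewrite 3 [← Real.rpow_one (u x)]
    rw [← Real.rpow_add hux]
    simp
  rw [fieldDiv_radialField hx hp, lowerE, hinner, hG, hpow, hpow2, hp₁, hp₂]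
  field_simp
  ring

end LowerOrder

section Contact

variable {N : ℕ} {ρ lam τ θ q : ℝ} {Ω : Set (EuclideanSpace ℝ (Fin N))}
  {u : EuclideanSpace ℝ (Fin N) → ℝ}

/-- The radial operator in the variable `t = log ‖x‖` acting on `exp (w t + z)`, where `p = z'`. -/
def hFun (w ρ lam τ p : ℝ) : ℝ := (w + p) ^ 2 - 2 * ρ * (w + p) + lam * |w + p| ^ (1 - τ)

/-- The logarithm of `u` relative to the power `‖x‖ ^ w`. -/
def relLog (w : ℝ) (u : EuclideanSpace ℝ (Fin N) → ℝ) (x : EuclideanSpace ℝ (Fin N)) : ℝ :=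
  Real.log (u x) - w * Real.log ‖x‖

lemma exp_relLog_eq {w : ℝ} (hθ : θ + 2 = -w * (q - 1)) {x : EuclideanSpace ℝ (Fin N)}
    (hx : x ≠ 0) (hux : 0 < u x) :
    ‖x‖ ^ (θ + 2) * u x ^ (q - 1) = Real.exp ((q - 1) * relLog w u x) := by
  rw [Real.rpow_def_of_pos (norm_pos_iff.2 hx), Real.rpow_def_of_pos hux, ← Real.exp_add, relLog,
    hθ]
  congr 1
  ring

/-- The radial function `p (log ‖x‖) = k ‖x‖ ^ w exp (z (log ‖x‖))` which agrees with `u`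
at `x₀`. -/
lemma exists_radial_barrier (hu : PosC1 Ω u) {w : ℝ} {x₀ : EuclideanSpace ℝ (Fin N)}
    (hx₀ : x₀ ∈ Ω \ {0}) {z z₁ : ℝ → ℝ} {z₂ : ℝ}
    (hz : ∀ᶠ t in 𝓝 (Real.log ‖x₀‖), HasDerivAt z (z₁ t) t)
    (hzc : ContDiffAt ℝ 1 z (Real.log ‖x₀‖)) (hz₁c : ContDiffAt ℝ 1 z₁ (Real.log ‖x₀‖))
    (hz₁ : HasDerivAt z₁ z₂ (Real.log ‖x₀‖)) :
    ∃ (p p₁ : ℝ → ℝ) (p₂ : ℝ), (∀ᶠ t in 𝓝 (Real.log ‖x₀‖), HasDerivAt p (p₁ t) t) ∧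
      ContDiffAt ℝ 1 p₁ (Real.log ‖x₀‖) ∧ HasDerivAt p₁ p₂ (Real.log ‖x₀‖) ∧
      p (Real.log ‖x₀‖) = u x₀ ∧ p₁ (Real.log ‖x₀‖) = (w + z₁ (Real.log ‖x₀‖)) * u x₀ ∧
      p₂ = (z₂ + (w + z₁ (Real.log ‖x₀‖)) ^ 2) * u x₀ ∧
      ∀ x ∈ Ω \ {0},
        (relLog w u x - z (Real.log ‖x‖) ≤ relLog w u x₀ - z (Real.log ‖x₀‖) →
          u x ≤ p (Real.log ‖x‖)) ∧
        (relLog w u x₀ - z (Real.log ‖x₀‖) ≤ relLog w u x - z (Real.log ‖x‖) →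
          p (Real.log ‖x‖) ≤ u x) := by
  set t₀ := Real.log ‖x₀‖ with ht₀
  have hux := hu.2 x₀ hx₀
  set k := relLog w u x₀ - z t₀ with hk
  set p : ℝ → ℝ := fun t => Real.exp (w * t + z t + k) with hpdef
  have hp0 : p t₀ = u x₀ := by
    rw [hpdef]
    simp only [hk, relLog, ← ht₀]
    rw [show w * t₀ + z t₀ + (Real.log (u x₀) - w * t₀ - z t₀) = Real.log (u x₀) by ring,
      Real.exp_log hux]
  have hpd : ∀ t, HasDerivAt z (z₁ t) t → HasDerivAt p ((w + z₁ t) * p t) t := fun t ht => by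
    have h1 := ((((hasDerivAt_id t).const_mul w).add ht).add_const k).exp
    refine h1.congr_deriv ?_
    simp [hpdef]
    ring
  have hpc : ContDiffAt ℝ 1 p t₀ :=
    (((contDiffAt_const.mul contDiffAt_id).add hzc).add contDiffAt_const).exp
  refine ⟨p, fun t => (w + z₁ t) * p t, _, hz.mono hpd, (contDiffAt_const.add hz₁c).mul hpc,
    (hz₁.const_add w).mul (hpd t₀ hz.self_of_nhds), hp0, by simp only [hp0], by rw [hp0]; ring, ?_⟩
  intro x hx
  have hexp : u x = Real.exp (w * Real.log ‖x‖ + relLog w u x) := by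
    rw [relLog, add_sub_cancel, Real.exp_log (hu.2 x hx)]
  rw [hexp]
  simp only [hpdef, Real.exp_le_exp]
  exact ⟨fun h => by linarith, fun h => by linarith⟩

/-- If `log u - w log ‖x‖ - z (log ‖x‖)` has a local maximum, then `z` satisfies the subsolution
inequality there. -/
lemma exp_relLog_le_of_isLocalMax (hΩ : IsOpen Ω) (hτ1 : τ < 1)
    (hu : IsSolutionE N ρ lam τ θ q Ω u) {w : ℝ} (hθ : θ + 2 = -w * (q - 1))
    {x₀ : EuclideanSpace ℝ (Fin N)} (hx₀ : x₀ ∈ Ω \ {0}) {z z₁ : ℝ → ℝ} {z₂ : ℝ}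
    (hz : ∀ᶠ t in 𝓝 (Real.log ‖x₀‖), HasDerivAt z (z₁ t) t)
    (hzc : ContDiffAt ℝ 1 z (Real.log ‖x₀‖)) (hz₁c : ContDiffAt ℝ 1 z₁ (Real.log ‖x₀‖))
    (hz₁ : HasDerivAt z₁ z₂ (Real.log ‖x₀‖))
    (hmax : IsLocalMax (fun x => relLog w u x - z (Real.log ‖x‖)) x₀) :
    Real.exp ((q - 1) * relLog w u x₀) ≤ z₂ + hFun w ρ lam τ (z₁ (Real.log ‖x₀‖)) := by
  have hne : x₀ ≠ 0 := hx₀.2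
  have hux := hu.1.2 x₀ hx₀
  have hO := isOpen_punctured hΩ
  obtain ⟨p, p₁, p₂, hp, hpc, hp₁, hpx, hp₁x, hp₂x, hpev⟩ :=
    exists_radial_barrier hu.1 (w := w) hx₀ hz hzc hz₁c hz₁
  have hP : ∀ᶠ x in 𝓝 x₀, HasGradientAt (fun y : EuclideanSpace ℝ (Fin N) => p (Real.log ‖y‖))
      (radialField p₁ x) x := by
    filter_upwards [(hasFDerivAt_log_norm hne).continuousAt.eventually hp, hO.eventually_mem hx₀]
      with x h1 h2 using hasGradientAt_radial h2.2 h1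
  have hloc : IsLocalMax (fun x => u x - p (Real.log ‖x‖)) x₀ := by
    filter_upwards [hmax, hO.eventually_mem hx₀] with x h1 h2
    have h3 := (hpev x h2).1 (by linarith)
    simp only [hpx]
    linarith
  have hgrad : gradient u x₀ = radialField p₁ x₀ := by
    have h1 : HasFDerivAt u _ x₀ := (((hu.1.1.differentiableOn one_ne_zero).differentiableAt
      (hO.mem_nhds hx₀)).hasGradientAt).hasFDerivAt
    have h2 := hloc.hasFDerivAt_eq_zero (h1.sub hP.self_of_nhds.hasFDerivAt)
    rw [← map_sub] at h2
    exact sub_eq_zero.1 ((map_eq_zero_iff _ (InnerProductSpace.toDual ℝ _).injective).1 h2)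
  have key := fieldDiv_add_nonneg_of_isLocalMax hO hu.1.1 (continuousOn_lowerE hΩ hτ1 hu.1)
    (fun φ h1 h2 h3 => weak_identity_of_isSolutionE hΩ hτ1 hu h1 h2 h3) hx₀ hP
    (contDiffAt_radialField hne hpc) hloc
  rw [fieldDiv_add_lowerE_eq hne hux hp₁ hp₁x hp₂x hgrad, exp_relLog_eq hθ hne hux] at key
  have hpos : 0 < u x₀ / ‖x₀‖ ^ 2 := by
    have := norm_pos_iff.2 hne
    positivity
  have := nonneg_of_mul_nonneg_right key hpos
  rw [hFun]
  linarith

lemma le_exp_relLog_of_isLocalMin (hΩ : IsOpen Ω) (hτ1 : τ < 1)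
    (hu : IsSolutionE N ρ lam τ θ q Ω u) {w : ℝ} (hθ : θ + 2 = -w * (q - 1))
    {x₀ : EuclideanSpace ℝ (Fin N)} (hx₀ : x₀ ∈ Ω \ {0}) {z z₁ : ℝ → ℝ} {z₂ : ℝ}
    (hz : ∀ᶠ t in 𝓝 (Real.log ‖x₀‖), HasDerivAt z (z₁ t) t)
    (hzc : ContDiffAt ℝ 1 z (Real.log ‖x₀‖)) (hz₁c : ContDiffAt ℝ 1 z₁ (Real.log ‖x₀‖))
    (hz₁ : HasDerivAt z₁ z₂ (Real.log ‖x₀‖))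
    (hmin : IsLocalMin (fun x => relLog w u x - z (Real.log ‖x‖)) x₀) :
    z₂ + hFun w ρ lam τ (z₁ (Real.log ‖x₀‖)) ≤ Real.exp ((q - 1) * relLog w u x₀) := by
  have hne : x₀ ≠ 0 := hx₀.2
  have hux := hu.1.2 x₀ hx₀
  have hO := isOpen_punctured hΩ
  obtain ⟨p, p₁, p₂, hp, hpc, hp₁, hpx, hp₁x, hp₂x, hpev⟩ :=
    exists_radial_barrier hu.1 (w := w) hx₀ hz hzc hz₁c hz₁
  have hP : ∀ᶠ x in 𝓝 x₀, HasGradientAt (fun y : EuclideanSpace ℝ (Fin N) => p (Real.log ‖y‖))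
      (radialField p₁ x) x := by
    filter_upwards [(hasFDerivAt_log_norm hne).continuousAt.eventually hp, hO.eventually_mem hx₀]
      with x h1 h2 using hasGradientAt_radial h2.2 h1
  have hloc : IsLocalMin (fun x => u x - p (Real.log ‖x‖)) x₀ := by
    filter_upwards [hmin, hO.eventually_mem hx₀] with x h1 h2
    have h3 := (hpev x h2).2 (by linarith)
    simp only [hpx]
    linarith
  have hgrad : gradient u x₀ = radialField p₁ x₀ := by
    have h1 : HasFDerivAt u _ x₀ := (((hu.1.1.differentiableOn one_ne_zero).differentiableAt
      (hO.mem_nhds hx₀)).hasGradientAt).hasFDerivAt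
    have h2 := hloc.hasFDerivAt_eq_zero (h1.sub hP.self_of_nhds.hasFDerivAt)
    rw [← map_sub] at h2
    exact sub_eq_zero.1 ((map_eq_zero_iff _ (InnerProductSpace.toDual ℝ _).injective).1 h2)
  have key := fieldDiv_add_nonpos_of_isLocalMin hO hu.1.1 (continuousOn_lowerE hΩ hτ1 hu.1)
    (fun φ h1 h2 h3 => weak_identity_of_isSolutionE hΩ hτ1 hu h1 h2 h3) hx₀ hP
    (contDiffAt_radialField hne hpc) hloc
  rw [fieldDiv_add_lowerE_eq hne hux hp₁ hp₁x hp₂x hgrad, exp_relLog_eq hθ hne hux] at key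
  have hpos : 0 < u x₀ / ‖x₀‖ ^ 2 := by
    have := norm_pos_iff.2 hne
    positivity
  have := nonpos_of_mul_nonpos_right key hpos
  rw [hFun]
  linarith

end Contact

section StructureFunction

lemma le_of_hasDerivAt_le {f g f' g' : ℝ → ℝ} (hf : ∀ x, 0 ≤ x → HasDerivAt f (f' x) x)
    (hg : ∀ x, 0 ≤ x → HasDerivAt g (g' x) x) (h0 : f 0 ≤ g 0)
    (h : ∀ x, 0 ≤ x → f' x ≤ g' x) {x : ℝ} (hx : 0 ≤ x) : f x ≤ g x := by
  have hd : ∀ y, 0 ≤ y → HasDerivAt (fun y => g y - f y) (g' y - f' y) y :=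
    fun y hy => (hg y hy).sub (hf y hy)
  have hmono : MonotoneOn (fun y => g y - f y) (Set.Ici 0) := by
    refine monotoneOn_of_deriv_nonneg (convex_Ici 0)
      (fun y hy => (hd y hy).continuousAt.continuousWithinAt)
      (fun y hy => ?_) fun y hy => ?_
    · rw [interior_Ici] at hy
      exact (hd y hy.le).differentiableAt.differentiableWithinAt
    · rw [interior_Ici] at hy
      rw [(hd y hy.le).deriv]
      linarith [h y hy.le]
  have := hmono (Set.mem_Ici.2 le_rfl) (Set.mem_Ici.2 hx) hx
  simp only at this
  linarith

lemma hasDerivAt_one_add_rpow (s : ℝ) {x : ℝ} (hx : 0 ≤ x) :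
    HasDerivAt (fun x : ℝ => (1 + x) ^ s) (s * (1 + x) ^ (s - 1)) x := by
  have h := ((hasDerivAt_id x).const_add 1).rpow_const (p := s)
    (Or.inl (by simp only [id]; positivity))
  simpa using h

lemma one_sub_mul_le_rpow_neg {a x : ℝ} (ha : 0 ≤ a) (hx : 0 ≤ x) :
    1 - a * x ≤ (1 + x) ^ (-a) := by
  refine le_of_hasDerivAt_le (f := fun x => 1 - a * x) (g := fun x => (1 + x) ^ (-a))
    (f' := fun _ => -a) (g' := fun x => -a * (1 + x) ^ (-a - 1)) (fun y _ => ?_)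
    (fun y hy => hasDerivAt_one_add_rpow _ hy) (by simp) (fun y hy => ?_) hx
  · simpa using ((hasDerivAt_id y).const_mul a).const_sub 1
  · have : (1 + y) ^ (-a - 1) ≤ 1 :=
      Real.rpow_le_one_of_one_le_of_nonpos (by linarith) (by linarith)
    nlinarith

lemma rpow_neg_le_quadratic {a x : ℝ} (ha : 0 ≤ a) (hx : 0 ≤ x) :
    (1 + x) ^ (-a) ≤ 1 - a * x + a * (a + 1) / 2 * x ^ 2 := by
  refine le_of_hasDerivAt_le (f := fun x => (1 + x) ^ (-a))
    (g := fun x => 1 - a * x + a * (a + 1) / 2 * x ^ 2)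
    (f' := fun x => -a * (1 + x) ^ (-a - 1)) (g' := fun x => -a + a * (a + 1) * x)
    (fun y hy => hasDerivAt_one_add_rpow _ hy) (fun y _ => ?_) (by simp) (fun y hy => ?_) hx
  · have h := (((hasDerivAt_id y).const_mul a).const_sub 1).add
      ((hasDerivAt_pow 2 y).const_mul (a * (a + 1) / 2))
    refine h.congr_deriv ?_
    simp
    ring
  · have h := one_sub_mul_le_rpow_neg (a := a + 1) (by linarith) hy
    rw [show -(a + 1) = -a - 1 by ring] at h
    nlinarith

lemma quadratic_le_one_add_rpow {τ x : ℝ} (hτ0 : 0 ≤ τ) (hτ1 : τ ≤ 1) (hx : 0 ≤ x) :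
    1 + (1 - τ) * x - (1 - τ) * τ / 2 * x ^ 2 ≤ (1 + x) ^ (1 - τ) := by
  refine le_of_hasDerivAt_le (g := fun x => (1 + x) ^ (1 - τ))
    (f := fun x => 1 + (1 - τ) * x - (1 - τ) * τ / 2 * x ^ 2)
    (g' := fun x => (1 - τ) * (1 + x) ^ (1 - τ - 1))
    (f' := fun x => (1 - τ) - (1 - τ) * τ * x)
    (fun y _ => ?_) (fun y hy => hasDerivAt_one_add_rpow _ hy) (by simp) (fun y hy => ?_) hx
  · have h := (((hasDerivAt_id y).const_mul (1 - τ)).const_add 1).sub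
      ((hasDerivAt_pow 2 y).const_mul ((1 - τ) * τ / 2))
    refine h.congr_deriv ?_
    simp
    ring
  · have h := one_sub_mul_le_rpow_neg hτ0 hy
    rw [show 1 - τ - 1 = -τ by ring]
    nlinarith

lemma one_add_rpow_le_cubic {τ x : ℝ} (hτ0 : 0 ≤ τ) (hτ1 : τ ≤ 1) (hx : 0 ≤ x) :
    (1 + x) ^ (1 - τ) ≤ 1 + (1 - τ) * x - (1 - τ) * τ / 2 * x ^ 2
      + (1 - τ) * τ * (τ + 1) / 6 * x ^ 3 := by
  refine le_of_hasDerivAt_le (f := fun x => (1 + x) ^ (1 - τ))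
    (g := fun x => 1 + (1 - τ) * x - (1 - τ) * τ / 2 * x ^ 2
      + (1 - τ) * τ * (τ + 1) / 6 * x ^ 3)
    (f' := fun x => (1 - τ) * (1 + x) ^ (1 - τ - 1))
    (g' := fun x => (1 - τ) - (1 - τ) * τ * x + (1 - τ) * τ * (τ + 1) / 2 * x ^ 2)
    (fun y hy => hasDerivAt_one_add_rpow _ hy) (fun y _ => ?_) (by simp) (fun y hy => ?_) hx
  · have h := ((((hasDerivAt_id y).const_mul (1 - τ)).const_add 1).sub
      ((hasDerivAt_pow 2 y).const_mul ((1 - τ) * τ / 2))).add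
      ((hasDerivAt_pow 3 y).const_mul ((1 - τ) * τ * (τ + 1) / 6))
    refine h.congr_deriv ?_
    simp
    ring
  · have h := rpow_neg_le_quadratic hτ0 hy
    rw [show 1 - τ - 1 = -τ by ring]
    have := mul_le_mul_of_nonneg_left h (by linarith : 0 ≤ 1 - τ)
    linarith

variable {w ρ lam τ : ℝ}

lemma hFun_scaled (hw : 0 < w) (hτ0 : 0 < τ) (hlam : w ^ (τ + 1) = lam * τ)
    (hρ : ρ = (τ + 1) / (2 * τ) * w) (x : ℝ) :
    hFun w ρ lam τ (w * x)
      = w ^ 2 * ((1 + x) ^ 2 - (τ + 1) / τ * (1 + x) + 1 / τ * |1 + x| ^ (1 - τ)) := by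
  have h1 : lam * w ^ (1 - τ) = w ^ 2 / τ := by
    have h2 : w ^ (τ + 1) * w ^ (1 - τ) = w ^ 2 := by
      rw [← Real.rpow_add hw, ← Real.rpow_two]
      congr 1
      ring
    rw [← h2, hlam]
    field_simp
  have h3 : |w + w * x| ^ (1 - τ) = w ^ (1 - τ) * |1 + x| ^ (1 - τ) := by
    rw [show w + w * x = w * (1 + x) by ring, abs_mul, abs_of_pos hw,
      Real.mul_rpow hw.le (abs_nonneg _)]
  rw [hFun, h3, ← mul_assoc, h1, hρ]
  field_simp

lemma quadratic_le_hFun (hw : 0 < w) (hτ0 : 0 < τ) (hτ1 : τ < 1)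
    (hlam : w ^ (τ + 1) = lam * τ) (hρ : ρ = (τ + 1) / (2 * τ) * w) {p : ℝ} (hp : 0 ≤ p) :
    (1 + τ) / 2 * p ^ 2 ≤ hFun w ρ lam τ p := by
  obtain ⟨x, rfl⟩ : ∃ x, p = w * x := ⟨p / w, by field_simp⟩
  have hx : 0 ≤ x := nonneg_of_mul_nonneg_right hp hw
  rw [hFun_scaled hw hτ0 hlam hρ, abs_of_nonneg (by linarith), mul_pow]
  have h := mul_le_mul_of_nonneg_left (quadratic_le_one_add_rpow hτ0.le hτ1.le hx)
    (by positivity : 0 ≤ 1 / τ)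
  have e : (1 + x) ^ 2 - (τ + 1) / τ * (1 + x)
      + 1 / τ * (1 + (1 - τ) * x - (1 - τ) * τ / 2 * x ^ 2) = (1 + τ) / 2 * x ^ 2 := by
    field_simp
    ring
  have := mul_le_mul_of_nonneg_left (by linarith : (1 + τ) / 2 * x ^ 2 ≤
    (1 + x) ^ 2 - (τ + 1) / τ * (1 + x) + 1 / τ * (1 + x) ^ (1 - τ)) (sq_nonneg w)
  linarith

lemma hFun_le_cubic (hw : 0 < w) (hτ0 : 0 < τ) (hτ1 : τ < 1)
    (hlam : w ^ (τ + 1) = lam * τ) (hρ : ρ = (τ + 1) / (2 * τ) * w) {p : ℝ} (hp : 0 ≤ p) :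
    hFun w ρ lam τ p ≤ (1 + τ) / 2 * p ^ 2 + (1 - τ) * (τ + 1) / (6 * w) * p ^ 3 := by
  obtain ⟨x, rfl⟩ : ∃ x, p = w * x := ⟨p / w, by field_simp⟩
  have hx : 0 ≤ x := nonneg_of_mul_nonneg_right hp hw
  rw [hFun_scaled hw hτ0 hlam hρ, abs_of_nonneg (by linarith)]
  have h := mul_le_mul_of_nonneg_left (one_add_rpow_le_cubic hτ0.le hτ1.le hx)
    (by positivity : 0 ≤ 1 / τ)
  have e : (1 + x) ^ 2 - (τ + 1) / τ * (1 + x)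
      + 1 / τ * (1 + (1 - τ) * x - (1 - τ) * τ / 2 * x ^ 2
        + (1 - τ) * τ * (τ + 1) / 6 * x ^ 3)
      = (1 + τ) / 2 * x ^ 2 + (1 - τ) * (τ + 1) / 6 * x ^ 3 := by
    field_simp
    ring
  have e2 : (1 + τ) / 2 * (w * x) ^ 2 + (1 - τ) * (τ + 1) / (6 * w) * (w * x) ^ 3
      = w ^ 2 * ((1 + τ) / 2 * x ^ 2 + (1 - τ) * (τ + 1) / 6 * x ^ 3) := by
    field_simp
  rw [e2]
  exact mul_le_mul_of_nonneg_left (by linarith) (sq_nonneg w)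

lemma hFun_le_quadratic (hw : 0 < w) (hτ0 : 0 < τ) (hτ1 : τ < 1)
    (hlam : w ^ (τ + 1) = lam * τ) (hρ : ρ = (τ + 1) / (2 * τ) * w) (p : ℝ) :
    hFun w ρ lam τ p ≤ (2 + 2 / τ) * p ^ 2 := by
  obtain ⟨x, rfl⟩ : ∃ x, p = w * x := ⟨p / w, by field_simp⟩
  rw [hFun_scaled hw hτ0 hlam hρ, mul_pow, mul_left_comm]
  refine mul_le_mul_of_nonneg_left ?_ (sq_nonneg w)
  have hinv : 0 < 1 / τ := by positivity
  have e0 : (τ + 1) / τ = 1 + 1 / τ := by field_simp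
  have e1 : 2 / τ = 2 * (1 / τ) := by ring
  rw [e0, e1]
  rcases le_total 0 (1 + x) with h | h
  · rw [abs_of_nonneg h]
    have hB := mul_le_mul_of_nonneg_left (rpow_one_add_le_one_add_mul_self
      (by linarith : -1 ≤ x) (by linarith : 0 ≤ 1 - τ) (by linarith)) hinv.le
    have e : 1 / τ * (1 + (1 - τ) * x) = 1 / τ + 1 / τ * x - x := by
      field_simp
      ring
    nlinarith [mul_nonneg hinv.le (sq_nonneg x), sq_nonneg x]
  · rw [abs_of_nonpos h]
    set y := -(1 + x) with hy
    have hy0 : 0 ≤ y := by linarith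
    have hyp : y ^ (1 - τ) ≤ 1 + y := by
      have h1 : y ^ (1 - τ) ≤ (1 + y) ^ (1 - τ) :=
        Real.rpow_le_rpow hy0 (by linarith) (by linarith)
      have h2 : (1 + y) ^ (1 - τ) ≤ (1 + y) ^ (1 : ℝ) :=
        Real.rpow_le_rpow_of_exponent_le (by linarith) (by linarith)
      rw [Real.rpow_one] at h2
      linarith
    have hx : x = -(1 + y) := by rw [hy]; ring
    rw [hx]
    have hB := mul_le_mul_of_nonneg_left hyp hinv.le
    nlinarith [mul_nonneg hinv.le hy0, mul_nonneg hinv.le (mul_nonneg hy0 hy0),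
      mul_nonneg hy0 hy0]

end StructureFunction

section Asymptotics

variable {N : ℕ} {Ω : Set (EuclideanSpace ℝ (Fin N))} {Z : EuclideanSpace ℝ (Fin N) → ℝ}
  {q : ℝ} {h : ℝ → ℝ}

/-- `Z` is a viscosity subsolution of `Z'' + h(Z') = exp ((q - 1) Z)`, tested with functions of
`t = log ‖x‖`. -/
def SubContact (Ω : Set (EuclideanSpace ℝ (Fin N))) (Z : EuclideanSpace ℝ (Fin N) → ℝ) (q : ℝ)
    (h : ℝ → ℝ) : Prop :=
  ∀ x₀ ∈ Ω \ {0}, ∀ (z z₁ : ℝ → ℝ) (z₂ : ℝ),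
    (∀ᶠ t in 𝓝 (Real.log ‖x₀‖), HasDerivAt z (z₁ t) t) →
    ContDiffAt ℝ 1 z (Real.log ‖x₀‖) → ContDiffAt ℝ 1 z₁ (Real.log ‖x₀‖) →
    HasDerivAt z₁ z₂ (Real.log ‖x₀‖) →
    IsLocalMax (fun x => Z x - z (Real.log ‖x‖)) x₀ →
    Real.exp ((q - 1) * Z x₀) ≤ z₂ + h (z₁ (Real.log ‖x₀‖))

/-- `Z` is a viscosity supersolution of `Z'' + h(Z') = exp ((q - 1) Z)`, tested with functions of
`t = log ‖x‖`. -/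
def SuperContact (Ω : Set (EuclideanSpace ℝ (Fin N))) (Z : EuclideanSpace ℝ (Fin N) → ℝ) (q : ℝ)
    (h : ℝ → ℝ) : Prop :=
  ∀ x₀ ∈ Ω \ {0}, ∀ (z z₁ : ℝ → ℝ) (z₂ : ℝ),
    (∀ᶠ t in 𝓝 (Real.log ‖x₀‖), HasDerivAt z (z₁ t) t) →
    ContDiffAt ℝ 1 z (Real.log ‖x₀‖) → ContDiffAt ℝ 1 z₁ (Real.log ‖x₀‖) →
    HasDerivAt z₁ z₂ (Real.log ‖x₀‖) →
    IsLocalMin (fun x => Z x - z (Real.log ‖x‖)) x₀ →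
    z₂ + h (z₁ (Real.log ‖x₀‖)) ≤ Real.exp ((q - 1) * Z x₀)

/-- Closed annuli around the origin in logarithmic coordinates. -/
def logAnnulus (N : ℕ) (a b : ℝ) : Set (EuclideanSpace ℝ (Fin N)) :=
  {x | x ≠ 0 ∧ a ≤ Real.log ‖x‖ ∧ Real.log ‖x‖ ≤ b}

lemma isCompact_logAnnulus (a b : ℝ) : IsCompact (logAnnulus N a b) := by
  have he : logAnnulus N a b = Metric.closedBall 0 (Real.exp b) ∩ {x | Real.exp a ≤ ‖x‖} := by
    ext x
    simp only [logAnnulus, Set.mem_ofPred_eq, Set.mem_inter_iff, mem_closedBall_zero_iff]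
    constructor
    · rintro ⟨h0, h1, h2⟩
      have hn := norm_pos_iff.2 h0
      exact ⟨(Real.log_le_iff_le_exp hn).1 h2, (Real.le_log_iff_exp_le hn).1 h1⟩
    · rintro ⟨h1, h2⟩
      have hn : 0 < ‖x‖ := (Real.exp_pos a).trans_le h2
      exact ⟨norm_pos_iff.1 hn, (Real.le_log_iff_exp_le hn).2 h2,
        (Real.log_le_iff_le_exp hn).2 h1⟩
  rw [he]
  exact (isCompact_closedBall _ _).inter_right (isClosed_le continuous_const continuous_norm)

lemma continuousAt_log_norm {x : EuclideanSpace ℝ (Fin N)} (hx : x ≠ 0) :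
    ContinuousAt (fun y : EuclideanSpace ℝ (Fin N) => Real.log ‖y‖) x :=
  (hasFDerivAt_log_norm hx).continuousAt

lemma eventually_mem_logAnnulus {a b : ℝ} {x : EuclideanSpace ℝ (Fin N)} (hx : x ≠ 0)
    (ha : a < Real.log ‖x‖) (hb : Real.log ‖x‖ < b) : ∀ᶠ y in 𝓝 x, y ∈ logAnnulus N a b := by
  have hc := continuousAt_log_norm hx
  filter_upwards [hc.eventually_const_lt ha, hc.eventually_lt_const hb,
    isOpen_ne.eventually_mem hx] with y h1 h2 h3 using ⟨h3, h1.le, h2.le⟩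

/-- Derivatives of `s log φ`. -/
lemma hasDerivAt_mul_log {φ φ₁ : ℝ → ℝ} {φ₂ s t₀ : ℝ}
    (hφ : ∀ᶠ t in 𝓝 t₀, HasDerivAt φ (φ₁ t) t) (hφc : ContDiffAt ℝ 1 φ t₀)
    (hφ₁c : ContDiffAt ℝ 1 φ₁ t₀) (hφ₁ : HasDerivAt φ₁ φ₂ t₀) (hpos : 0 < φ t₀) :
    (∀ᶠ t in 𝓝 t₀, HasDerivAt (fun t => s * Real.log (φ t)) (s * (φ₁ t / φ t)) t) ∧
      ContDiffAt ℝ 1 (fun t => s * Real.log (φ t)) t₀ ∧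
      ContDiffAt ℝ 1 (fun t => s * (φ₁ t / φ t)) t₀ ∧
      HasDerivAt (fun t => s * (φ₁ t / φ t))
        (s * ((φ₂ * φ t₀ - φ₁ t₀ * φ₁ t₀) / φ t₀ ^ 2)) t₀ := by
  refine ⟨?_, contDiffAt_const.mul (hφc.log hpos.ne'),
    contDiffAt_const.mul (hφ₁c.div hφc hpos.ne'),
    (hφ₁.div hφ.self_of_nhds hpos.ne').const_mul s⟩
  filter_upwards [hφ, hφc.continuousAt.eventually_const_lt hpos] with t h1 h2
  exact (h1.log h2.ne').const_mul s

/-- A product bound for `exp (a Z) φ ^ s` in logarithmic form. -/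
lemma isLocalMax_add_log_of_mul_rpow_le {φ : ℝ → ℝ} {a s : ℝ} {x₀ : EuclideanSpace ℝ (Fin N)}
    (hx₀ : x₀ ≠ 0) (hφ : ContinuousAt φ (Real.log ‖x₀‖)) (hpos : 0 < φ (Real.log ‖x₀‖))
    (hmax : ∀ᶠ x in 𝓝 x₀, Real.exp (a * Z x) * φ (Real.log ‖x‖) ^ s
      ≤ Real.exp (a * Z x₀) * φ (Real.log ‖x₀‖) ^ s) :
    IsLocalMax (fun x => a * Z x + s * Real.log (φ (Real.log ‖x‖))) x₀ := by
  have hc : ContinuousAt (fun x : EuclideanSpace ℝ (Fin N) => φ (Real.log ‖x‖)) x₀ :=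
    ContinuousAt.comp (g := φ) hφ (continuousAt_log_norm hx₀)
  filter_upwards [hmax, hc.eventually_const_lt hpos] with x h1 h2
  rw [Real.rpow_def_of_pos h2, Real.rpow_def_of_pos hpos, ← Real.exp_add, ← Real.exp_add,
    Real.exp_le_exp] at h1
  linarith

/-- A subsolution touched by `-m log φ`. -/
lemma SubContact.mul_sq_le (hZ : SubContact Ω Z q h) {x₀ : EuclideanSpace ℝ (Fin N)}
    (hx₀ : x₀ ∈ Ω \ {0}) {φ φ₁ : ℝ → ℝ} {φ₂ m : ℝ}
    (hφ : ∀ᶠ t in 𝓝 (Real.log ‖x₀‖), HasDerivAt φ (φ₁ t) t)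
    (hφc : ContDiffAt ℝ 1 φ (Real.log ‖x₀‖)) (hφ₁c : ContDiffAt ℝ 1 φ₁ (Real.log ‖x₀‖))
    (hφ₁ : HasDerivAt φ₁ φ₂ (Real.log ‖x₀‖)) (hpos : 0 < φ (Real.log ‖x₀‖))
    (hmax : ∀ᶠ x in 𝓝 x₀, Real.exp (Z x) * φ (Real.log ‖x‖) ^ m
      ≤ Real.exp (Z x₀) * φ (Real.log ‖x₀‖) ^ m) :
    Real.exp ((q - 1) * Z x₀) * φ (Real.log ‖x₀‖) ^ 2
      ≤ m * (φ₁ (Real.log ‖x₀‖) ^ 2 - φ₂ * φ (Real.log ‖x₀‖))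
        + φ (Real.log ‖x₀‖) ^ 2 * h (-m * (φ₁ (Real.log ‖x₀‖) / φ (Real.log ‖x₀‖))) := by
  obtain ⟨h1, h2, h3, h4⟩ := hasDerivAt_mul_log (s := -m) hφ hφc hφ₁c hφ₁ hpos
  have hloc := isLocalMax_add_log_of_mul_rpow_le (a := 1) (s := m) hx₀.2 hφc.continuousAt hpos
    (by simpa using hmax)
  have key := hZ x₀ hx₀ _ _ _ h1 h2 h3 h4
    (hloc.congr (Eventually.of_forall fun x => by simp only; ring))
  have hsq : 0 < φ (Real.log ‖x₀‖) ^ 2 := by positivity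
  have := mul_le_mul_of_nonneg_right key hsq.le
  refine this.trans (le_of_eq ?_)
  field_simp
  ring

/-- A supersolution touched by `s log y`. -/
lemma SuperContact.le_exp (hZ : SuperContact Ω Z q h) {x₀ : EuclideanSpace ℝ (Fin N)}
    (hx₀ : x₀ ∈ Ω \ {0}) {y y₁ : ℝ → ℝ} {y₂ s : ℝ}
    (hy : ∀ᶠ t in 𝓝 (Real.log ‖x₀‖), HasDerivAt y (y₁ t) t)
    (hyc : ContDiffAt ℝ 1 y (Real.log ‖x₀‖)) (hy₁c : ContDiffAt ℝ 1 y₁ (Real.log ‖x₀‖))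
    (hy₁ : HasDerivAt y₁ y₂ (Real.log ‖x₀‖)) (hpos : 0 < y (Real.log ‖x₀‖))
    (hmax : ∀ᶠ x in 𝓝 x₀, Real.exp (-Z x) * y (Real.log ‖x‖) ^ s
      ≤ Real.exp (-Z x₀) * y (Real.log ‖x₀‖) ^ s) :
    s * ((y₂ * y (Real.log ‖x₀‖) - y₁ (Real.log ‖x₀‖) * y₁ (Real.log ‖x₀‖))
        / y (Real.log ‖x₀‖) ^ 2) + h (s * (y₁ (Real.log ‖x₀‖) / y (Real.log ‖x₀‖)))
      ≤ Real.exp ((q - 1) * Z x₀) := by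
  obtain ⟨h1, h2, h3, h4⟩ := hasDerivAt_mul_log (s := s) hy hyc hy₁c hy₁ hpos
  have hloc := isLocalMax_add_log_of_mul_rpow_le (a := -1) (s := s) hx₀.2 hyc.continuousAt hpos
    (by simpa using hmax)
  exact hZ x₀ hx₀ _ _ _ h1 h2 h3 h4
    (hloc.neg.congr (Eventually.of_forall fun x => by simp only; ring))

lemma continuousOn_exp_mul_rpow (hZc : ContinuousOn Z (Ω \ {0})) {a b c s : ℝ} (hs : 0 < s)
    {φ : ℝ → ℝ} (hφ : ContinuousOn φ (Set.Icc a b)) (hsub : logAnnulus N a b ⊆ Ω \ {0}) :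
    ContinuousOn (fun x => Real.exp (c * Z x) * φ (Real.log ‖x‖) ^ s) (logAnnulus N a b) := by
  have h1 : ContinuousOn (fun x : EuclideanSpace ℝ (Fin N) => Real.log ‖x‖) (logAnnulus N a b) :=
    fun x hx => (continuousAt_log_norm hx.1).continuousWithinAt
  have h2 : ContinuousOn (fun x : EuclideanSpace ℝ (Fin N) => φ (Real.log ‖x‖))
      (logAnnulus N a b) := hφ.comp h1 fun x hx => hx.2
  exact (continuousOn_const.mul (hZc.mono hsub)).rexp.mul
    (h2.rpow_const fun _ _ => Or.inr hs.le)

/-- A priori upper bound of Keller–Osserman type. -/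
lemma SubContact.exists_bound (hZ : SubContact Ω Z q h) (hZc : ContinuousOn Z (Ω \ {0}))
    (hq : 1 < q) {K T₀ : ℝ} (hK : 0 ≤ K) (hh : ∀ p, h p ≤ K * p ^ 2) (hT₀ : T₀ < 0)
    (hΩT : ∀ x : EuclideanSpace ℝ (Fin N), x ≠ 0 → Real.log ‖x‖ ≤ T₀ → x ∈ Ω \ {0}) :
    ∃ C > 0, ∀ x : EuclideanSpace ℝ (Fin N), x ≠ 0 → Real.log ‖x‖ ≤ 2 * T₀ →
      Real.exp (Z x) * (-Real.log ‖x‖ / 2) ^ (2 / (q - 1)) ≤ C := by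
  have hq1 : 0 < q - 1 := by linarith
  set m := 2 / (q - 1) with hm
  have hmpos : 0 < m := by positivity
  have hmq : m * (q - 1) = 2 := by rw [hm]; field_simp
  set M := 6 * m + 4 * K * m ^ 2 with hM
  have hMpos : 0 < M := by positivity
  refine ⟨M ^ (1 / (q - 1)), by positivity, fun x hx hxT => ?_⟩
  set s := Real.log ‖x‖ with hs
  set R := -s / 2 with hR
  have hRpos : 0 < R := by rw [hR]; linarith
  set φ : ℝ → ℝ := fun t => (R ^ 2 - (t - s) ^ 2) / R with hφ
  have hsub : logAnnulus N (s - R) (s + R) ⊆ Ω \ {0} := fun y hy =>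
    hΩT y hy.1 (hy.2.2.trans (by rw [hR]; linarith))
  have hxA : x ∈ logAnnulus N (s - R) (s + R) := ⟨hx, by linarith, by linarith⟩
  have hφs : φ s = R := by simp [hφ]; field_simp
  obtain ⟨x₀, hx₀, hmax⟩ := (isCompact_logAnnulus (s - R) (s + R)).exists_isMaxOn ⟨x, hxA⟩
    (continuousOn_exp_mul_rpow hZc (c := 1) hmpos (φ := φ) (by fun_prop) hsub)
  have hmax' : ∀ y ∈ logAnnulus N (s - R) (s + R), Real.exp (Z y) * φ (Real.log ‖y‖) ^ m
      ≤ Real.exp (Z x₀) * φ (Real.log ‖x₀‖) ^ m := fun y hy => by simpa using hmax hy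
  have hxx := hmax' x hxA
  rw [← hs, hφs] at hxx
  refine hxx.trans ?_
  set t := Real.log ‖x₀‖ with ht
  have hFpos : 0 < Real.exp (Z x₀) * φ t ^ m := lt_of_lt_of_le (by positivity) hxx
  have hφt0 : 0 ≤ φ t := by
    refine div_nonneg ?_ hRpos.le
    nlinarith [hx₀.2.1, hx₀.2.2]
  have hφt : 0 < φ t := by
    refine lt_of_le_of_ne hφt0 fun h0 => ?_
    rw [← h0, Real.zero_rpow hmpos.ne', mul_zero] at hFpos
    exact lt_irrefl _ hFpos
  have habs : (t - s) ^ 2 < R ^ 2 := by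
    have := (div_pos_iff_of_pos_right hRpos).1 hφt
    linarith
  have hlt := abs_lt_of_sq_lt_sq habs hRpos.le
  rw [abs_lt] at hlt
  have hφle : φ t ≤ R := by
    rw [hφ, div_le_iff₀ hRpos]
    nlinarith [sq_nonneg (t - s)]
  have hd : ∀ t', HasDerivAt φ (-2 * (t' - s) / R) t' := fun t' => by
    have h1 := ((((hasDerivAt_id t').sub_const s).pow 2).const_sub (R ^ 2)).div_const R
    refine h1.congr_deriv ?_
    simp
  have hd2 : HasDerivAt (fun t' => -2 * (t' - s) / R) (-2 / R) t := by
    have h1 := ((((hasDerivAt_id t).sub_const s)).const_mul (-2)).div_const R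
    simpa using h1
  have key := hZ.mul_sq_le (hsub hx₀) (φ := φ) (m := m) (Eventually.of_forall hd)
    (by fun_prop) (by fun_prop) hd2 hφt
    ((eventually_mem_logAnnulus hx₀.1 (by linarith) (by linarith)).mono hmax')
  rw [← ht] at key
  set d := -2 * (t - s) / R with hdd
  have hd4 : d ^ 2 ≤ 4 := by
    rw [hdd, div_pow, div_le_iff₀ (by positivity)]
    nlinarith
  have hb1 : φ t ^ 2 * h (-m * (d / φ t)) ≤ 4 * K * m ^ 2 := by
    have h1 := mul_le_mul_of_nonneg_left (hh (-m * (d / φ t))) (sq_nonneg (φ t))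
    have h2 : φ t ^ 2 * (K * (-m * (d / φ t)) ^ 2) = K * m ^ 2 * d ^ 2 := by
      field_simp
    have h3 : K * m ^ 2 * d ^ 2 ≤ K * m ^ 2 * 4 :=
      mul_le_mul_of_nonneg_left hd4 (by positivity)
    linarith
  have hb2 : -2 / R * φ t ≥ -2 := by
    rw [ge_iff_le, div_mul_eq_mul_div, le_div_iff₀ hRpos]
    linarith
  have hb3 : m * (d ^ 2 - -2 / R * φ t) ≤ m * 6 :=
    mul_le_mul_of_nonneg_left (by linarith) hmpos.le
  have hfin : (Real.exp (Z x₀) * φ t ^ m) ^ (q - 1) ≤ M := by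
    rw [Real.mul_rpow (Real.exp_pos _).le (by positivity), ← Real.rpow_mul hφt.le, hmq,
      ← Real.exp_mul, Real.rpow_two, mul_comm (Z x₀)]
    linarith
  have := Real.rpow_le_rpow (by positivity) hfin (by positivity : 0 ≤ 1 / (q - 1))
  rwa [← Real.rpow_mul hFpos.le, mul_one_div_cancel hq1.ne', Real.rpow_one] at this

/-- Comparison with `D (a + t₁ - t) ^ (-m')` for subcritical exponents `m'`. -/
lemma SubContact.mul_rpow_le_of_lt (hZ : SubContact Ω Z q h) (hZc : ContinuousOn Z (Ω \ {0}))
    (hq : 1 < q) {κ L T₀ C t₁ a D m' : ℝ} (hκ : 0 ≤ κ) (hL : 0 ≤ L)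
    (hh : ∀ p, 0 ≤ p → h p ≤ κ * p ^ 2 + L * p ^ 3) (hT₀ : T₀ < 0)
    (hΩT : ∀ x : EuclideanSpace ℝ (Fin N), x ≠ 0 → Real.log ‖x‖ ≤ T₀ → x ∈ Ω \ {0})
    (hC : ∀ x : EuclideanSpace ℝ (Fin N), x ≠ 0 → Real.log ‖x‖ ≤ 2 * T₀ →
      Real.exp (Z x) * (-Real.log ‖x‖ / 2) ^ (2 / (q - 1)) ≤ C)
    (ht₁ : t₁ ≤ 2 * T₀) (ha : 1 ≤ a) (hD : 0 < D)
    (hDa : 2 / (q - 1) + κ * (2 / (q - 1)) ^ 2 + L * (2 / (q - 1)) ^ 3 / a ≤ D ^ (q - 1))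
    (hbd : ∀ x : EuclideanSpace ℝ (Fin N), x ≠ 0 → Real.log ‖x‖ = t₁ →
      Real.exp (Z x) * a ^ (2 / (q - 1)) ≤ D)
    (hm0 : 0 < m') (hm' : m' < 2 / (q - 1)) {x : EuclideanSpace ℝ (Fin N)} (hx : x ≠ 0)
    (hxt : Real.log ‖x‖ ≤ t₁) : Real.exp (Z x) * (a + t₁ - Real.log ‖x‖) ^ m' ≤ D := by
  have hq1 : 0 < q - 1 := by linarith
  set m := 2 / (q - 1) with hm
  have hmq : m * (q - 1) = 2 := by rw [hm]; field_simp
  by_contra! hlt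
  have hlim : Tendsto (fun r : ℝ => C * 4 ^ m' * r ^ (-(m - m'))) atTop (𝓝 0) := by
    simpa using (tendsto_rpow_neg_atTop (sub_pos.2 hm')).const_mul (C * 4 ^ m')
  obtain ⟨R, hR⟩ := ((hlim.eventually_le_const hD).and (eventually_ge_atTop a)).exists_forall_of_atTop
  have hfar : ∀ y : EuclideanSpace ℝ (Fin N), y ≠ 0 → Real.log ‖y‖ ≤ t₁ →
      Real.log ‖y‖ ≤ -2 * R → Real.exp (Z y) * (a + t₁ - Real.log ‖y‖) ^ m' ≤ D := by
    intro y hy hyt hyR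
    obtain ⟨hr1, hr2⟩ := hR (-Real.log ‖y‖ / 2) (by linarith)
    refine le_trans ?_ hr1
    have hy1 := hC y hy (hyt.trans ht₁)
    set r := -Real.log ‖y‖ / 2 with hr
    have hrpos : 0 < r := by linarith
    have h1 : (a + t₁ - Real.log ‖y‖) ^ m' ≤ (4 * r) ^ m' :=
      Real.rpow_le_rpow (by linarith) (by linarith) hm0.le
    have h2 : Real.exp (Z y) ≤ C * r ^ (-m) := by
      rw [Real.rpow_neg hrpos.le, ← div_eq_mul_inv, le_div_iff₀ (by positivity)]
      exact hy1
    have hexp : r ^ (-(m - m')) = r ^ (-m) * r ^ m' := by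
      rw [← Real.rpow_add hrpos]; congr 1; ring
    calc Real.exp (Z y) * (a + t₁ - Real.log ‖y‖) ^ m'
        ≤ Real.exp (Z y) * (4 * r) ^ m' := mul_le_mul_of_nonneg_left h1 (Real.exp_pos _).le
      _ ≤ C * r ^ (-m) * (4 * r) ^ m' := mul_le_mul_of_nonneg_right h2 (by positivity)
      _ = C * 4 ^ m' * r ^ (-(m - m')) := by
        rw [Real.mul_rpow (by norm_num) hrpos.le, hexp]; ring
  set S := min (Real.log ‖x‖) (-2 * R) with hS
  have hsub : logAnnulus N S t₁ ⊆ Ω \ {0} := fun y hy => hΩT y hy.1 (by linarith [hy.2.2])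
  have hxA : x ∈ logAnnulus N S t₁ := ⟨hx, min_le_left _ _, hxt⟩
  set φ : ℝ → ℝ := fun t => a + t₁ - t with hφ
  obtain ⟨x₀, hx₀, hmax⟩ := (isCompact_logAnnulus S t₁).exists_isMaxOn ⟨x, hxA⟩
    (continuousOn_exp_mul_rpow hZc (c := 1) hm0 (φ := φ) (by fun_prop) hsub)
  have hmax' : ∀ y ∈ logAnnulus N S t₁, Real.exp (Z y) * φ (Real.log ‖y‖) ^ m'
      ≤ Real.exp (Z x₀) * φ (Real.log ‖x₀‖) ^ m' := fun y hy => by simpa using hmax hy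
  have hF : D < Real.exp (Z x₀) * φ (Real.log ‖x₀‖) ^ m' := lt_of_lt_of_le hlt (hmax' x hxA)
  have hne1 : Real.log ‖x₀‖ ≠ t₁ := by
    intro he
    have h1 := hbd x₀ hx₀.1 he
    have h2 : a ^ m' ≤ a ^ m := Real.rpow_le_rpow_of_exponent_le ha hm'.le
    have h3 := mul_le_mul_of_nonneg_left h2 (Real.exp_pos (Z x₀)).le
    have h4 : φ (Real.log ‖x₀‖) = a := by rw [hφ, he]; ring
    rw [h4] at hF
    linarith
  have hne2 : Real.log ‖x₀‖ ≠ S := by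
    intro he
    have := hfar x₀ hx₀.1 hx₀.2.2 (by rw [he]; exact min_le_right _ _)
    exact absurd hF (not_lt.2 this)
  set t := Real.log ‖x₀‖ with ht
  have hlt1 : t < t₁ := lt_of_le_of_ne hx₀.2.2 hne1
  have hφa : a ≤ φ t := by simp only [hφ]; linarith
  have hφt : 0 < φ t := by linarith
  have hd : ∀ t', HasDerivAt φ ((fun _ => (-1 : ℝ)) t') t' := fun t' => by
    simpa using (hasDerivAt_id t').const_sub (a + t₁)
  have key := hZ.mul_sq_le (hsub hx₀) (φ := φ) (φ₁ := fun _ => -1) (φ₂ := 0) (m := m')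
    (Eventually.of_forall hd) (by fun_prop) (by fun_prop) (hasDerivAt_const _ _) hφt
    ((eventually_mem_logAnnulus hx₀.1 (lt_of_le_of_ne hx₀.2.1 (Ne.symm hne2)) hlt1).mono hmax')
  rw [← ht] at key
  have hp : -m' * (-1 / φ t) = m' / φ t := by ring
  rw [hp] at key
  have h1 := mul_le_mul_of_nonneg_left (hh (m' / φ t) (by positivity)) (sq_nonneg (φ t))
  have h2 : φ t ^ 2 * (κ * (m' / φ t) ^ 2 + L * (m' / φ t) ^ 3) = κ * m' ^ 2 + L * m' ^ 3 / φ t := by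
    field_simp
  have h3 : κ * m' ^ 2 ≤ κ * m ^ 2 := by gcongr
  have h4 : L * m' ^ 3 / φ t ≤ L * m ^ 3 / a := by gcongr
  have h5 : (Real.exp (Z x₀) * φ t ^ m') ^ (q - 1) ≤ D ^ (q - 1) := by
    rw [Real.mul_rpow (Real.exp_pos _).le (by positivity), ← Real.rpow_mul hφt.le,
      ← Real.exp_mul, mul_comm (Z x₀)]
    have h6 : φ t ^ (m' * (q - 1)) ≤ φ t ^ (2 : ℝ) := by
      refine Real.rpow_le_rpow_of_exponent_le (ha.trans hφa) ?_
      rw [← hmq]; gcongr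
    rw [Real.rpow_two] at h6
    have h7 := mul_le_mul_of_nonneg_left h6 (Real.exp_pos ((q - 1) * Z x₀)).le
    linarith
  exact absurd hF (not_lt.2 ((Real.rpow_le_rpow_iff (by positivity) hD.le hq1).1 h5))

/-- Comparison with `D (a + t₁ - t) ^ (-2 / (q - 1))`. -/
lemma SubContact.mul_rpow_le (hZ : SubContact Ω Z q h) (hZc : ContinuousOn Z (Ω \ {0}))
    (hq : 1 < q) {κ L T₀ C t₁ a D : ℝ} (hκ : 0 ≤ κ) (hL : 0 ≤ L)
    (hh : ∀ p, 0 ≤ p → h p ≤ κ * p ^ 2 + L * p ^ 3) (hT₀ : T₀ < 0)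
    (hΩT : ∀ x : EuclideanSpace ℝ (Fin N), x ≠ 0 → Real.log ‖x‖ ≤ T₀ → x ∈ Ω \ {0})
    (hC : ∀ x : EuclideanSpace ℝ (Fin N), x ≠ 0 → Real.log ‖x‖ ≤ 2 * T₀ →
      Real.exp (Z x) * (-Real.log ‖x‖ / 2) ^ (2 / (q - 1)) ≤ C)
    (ht₁ : t₁ ≤ 2 * T₀) (ha : 1 ≤ a) (hD : 0 < D)
    (hDa : 2 / (q - 1) + κ * (2 / (q - 1)) ^ 2 + L * (2 / (q - 1)) ^ 3 / a ≤ D ^ (q - 1))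
    (hbd : ∀ x : EuclideanSpace ℝ (Fin N), x ≠ 0 → Real.log ‖x‖ = t₁ →
      Real.exp (Z x) * a ^ (2 / (q - 1)) ≤ D)
    {x : EuclideanSpace ℝ (Fin N)} (hx : x ≠ 0) (hxt : Real.log ‖x‖ ≤ t₁) :
    Real.exp (Z x) * (a + t₁ - Real.log ‖x‖) ^ (2 / (q - 1)) ≤ D := by
  have hmpos : 0 < 2 / (q - 1) := div_pos two_pos (by linarith)
  have hc : Tendsto (fun m' => Real.exp (Z x) * (a + t₁ - Real.log ‖x‖) ^ m')
      (𝓝[<] (2 / (q - 1))) (𝓝 (Real.exp (Z x) * (a + t₁ - Real.log ‖x‖) ^ (2 / (q - 1)))) :=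
    ((Real.continuousAt_const_rpow (by linarith : a + t₁ - Real.log ‖x‖ ≠ 0)).tendsto.const_mul
      _).mono_left nhdsWithin_le_nhds
  refine le_of_tendsto hc ?_
  filter_upwards [Ioo_mem_nhdsLT hmpos] with m' hm'
  exact hZ.mul_rpow_le_of_lt hZc hq hκ hL hh hT₀ hΩT hC ht₁ ha hD hDa hbd hm'.1 hm'.2 hx hxt

/-- Shifting the logarithm does not change the leading order. -/
lemma tendsto_ratio_rpow (b m : ℝ) :
    Tendsto (fun t : ℝ => (-t / (b - t)) ^ m) atBot (𝓝 1) := by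
  have h1 : Tendsto (fun t : ℝ => b - t) atBot atTop :=
    tendsto_atTop_add_const_left _ b tendsto_neg_atBot_atTop
  have h2 : Tendsto (fun t : ℝ => 1 - b * (b - t)⁻¹) atBot (𝓝 1) := by
    simpa using (h1.inv_tendsto_atTop.const_mul b).const_sub 1
  have h3 : Tendsto (fun t : ℝ => -t / (b - t)) atBot (𝓝 1) := by
    refine h2.congr' ?_
    filter_upwards [h1.eventually_gt_atTop 0] with t ht
    field_simp
    ring
  simpa using h3.rpow_const (p := m) (Or.inl one_ne_zero)

/-- Sharp asymptotic upper bound. -/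
lemma SubContact.eventually_lt (hZ : SubContact Ω Z q h) (hZc : ContinuousOn Z (Ω \ {0}))
    (hq : 1 < q) {K κ L T₀ D : ℝ} (hK : 0 ≤ K) (hκ : 0 ≤ κ) (hL : 0 ≤ L)
    (hhK : ∀ p, h p ≤ K * p ^ 2)
    (hh : ∀ p, 0 ≤ p → h p ≤ κ * p ^ 2 + L * p ^ 3) (hT₀ : T₀ < 0)
    (hΩT : ∀ x : EuclideanSpace ℝ (Fin N), x ≠ 0 → Real.log ‖x‖ ≤ T₀ → x ∈ Ω \ {0})
    (hD : (2 / (q - 1) + κ * (2 / (q - 1)) ^ 2) ^ (1 / (q - 1)) < D) :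
    ∃ t₀ < 0, ∀ x : EuclideanSpace ℝ (Fin N), x ≠ 0 → Real.log ‖x‖ ≤ t₀ →
      Real.exp (Z x) * (-Real.log ‖x‖) ^ (2 / (q - 1)) < D := by
  have hq1 : 0 < q - 1 := by linarith
  obtain ⟨C, hC0, hC⟩ := hZ.exists_bound hZc hq hK hhK hT₀ hΩT
  set m := 2 / (q - 1) with hm
  have hmpos : 0 < m := by positivity
  set A := m + κ * m ^ 2 with hA
  have hApos : 0 < A := by positivity
  set c₀ := A ^ (1 / (q - 1)) with hc₀
  have hc₀pos : 0 < c₀ := by positivity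
  obtain ⟨D₁, hD₁, hD₁D⟩ := exists_between hD
  have hD₁pos : 0 < D₁ := hc₀pos.trans hD₁
  have hAD : A < D₁ ^ (q - 1) := by
    have := Real.rpow_lt_rpow hc₀pos.le hD₁ hq1
    rwa [hc₀, ← Real.rpow_mul hApos.le, one_div_mul_cancel hq1.ne', Real.rpow_one] at this
  set c := (c₀ / C) ^ (1 / m) with hc
  have hcpos : 0 < c := by positivity
  have hcm : C * c ^ m = c₀ := by
    rw [hc, ← Real.rpow_mul (by positivity), one_div_mul_cancel hmpos.ne', Real.rpow_one]
    field_simp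
  have hlim : Tendsto (fun a : ℝ => A + L * m ^ 3 / a) atTop (𝓝 A) := by
    simpa [div_eq_mul_inv] using
      (tendsto_inv_atTop_zero.const_mul (L * m ^ 3)).const_add A
  obtain ⟨a, ⟨haD, ha1⟩, haT⟩ := (((hlim.eventually_le_const hAD).and
    (eventually_ge_atTop 1)).and (eventually_ge_atTop (c * -T₀))).exists
  set t₁ := -2 * a / c with ht₁
  have hact : a = c * (-t₁ / 2) := by rw [ht₁]; field_simp
  have ht₁T : t₁ ≤ 2 * T₀ := by
    rw [ht₁, div_le_iff₀ hcpos]; linarith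
  have hbd : ∀ x : EuclideanSpace ℝ (Fin N), x ≠ 0 → Real.log ‖x‖ = t₁ →
      Real.exp (Z x) * a ^ m ≤ D₁ := by
    intro x hx hxt
    have h1 := hC x hx (by rw [hxt]; exact ht₁T)
    rw [hxt] at h1
    rw [hact, Real.mul_rpow hcpos.le (by linarith)]
    have h2 := mul_le_mul_of_nonneg_right h1 (by positivity : 0 ≤ c ^ m)
    rw [hcm] at h2
    linarith
  have hmain := fun (x : EuclideanSpace ℝ (Fin N)) (hx : x ≠ 0) (hxt : Real.log ‖x‖ ≤ t₁) =>
    hZ.mul_rpow_le hZc hq hκ hL hh hT₀ hΩT hC ht₁T ha1 hD₁pos haD hbd hx hxt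
  have hr : Tendsto (fun t : ℝ => D₁ * (-t / (a + t₁ - t)) ^ m) atBot (𝓝 D₁) := by
    simpa using (tendsto_ratio_rpow (a + t₁) m).const_mul D₁
  obtain ⟨t₀, ht₀⟩ := ((hr.eventually_lt_const hD₁D).and
    ((eventually_lt_atBot 0).and (eventually_le_atBot t₁))).exists_forall_of_atBot
  refine ⟨t₀, (ht₀ t₀ le_rfl).2.1, fun x hx hxt => ?_⟩
  obtain ⟨h1, h2, h3⟩ := ht₀ _ hxt
  refine lt_of_le_of_lt ?_ h1
  have h4 := hmain x hx h3
  have h5 : 0 < a + t₁ - Real.log ‖x‖ := by linarith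
  rw [Real.div_rpow (by linarith) h5.le, mul_div_assoc', le_div_iff₀ (by positivity)]
  have h6 := mul_le_mul_of_nonneg_right h4 (Real.rpow_nonneg (by linarith : 0 ≤ -Real.log ‖x‖) m)
  linarith

lemma hasDerivAt_sub_rpow {b₀ t : ℝ} (s : ℝ) (ht : t < b₀) :
    HasDerivAt (fun t => (b₀ - t) ^ s) (-s * (b₀ - t) ^ (s - 1)) t := by
  have := ((hasDerivAt_id t).const_sub b₀).rpow_const (p := s) (Or.inl (sub_pos.2 ht).ne')
  refine this.congr_deriv ?_
  simp

lemma contDiffAt_sub_rpow {b₀ t : ℝ} (s : ℝ) (ht : t < b₀) :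
    ContDiffAt ℝ 1 (fun t => (b₀ - t) ^ s) t :=
  (contDiffAt_const.sub contDiffAt_id).rpow_const_of_ne (ne_of_gt (sub_pos.2 ht))

/-- Comparison from below on a truncated annulus. -/
lemma SuperContact.exp_neg_mul_rpow_le (hZ : SuperContact Ω Z q h)
    (hZc : ContinuousOn Z (Ω \ {0})) (hq : 1 < q) {κ T₀ t₁ b₀ T c : ℝ} (hκ : 0 < κ)
    (hh : ∀ p, 0 ≤ p → κ * p ^ 2 ≤ h p)
    (hΩT : ∀ x : EuclideanSpace ℝ (Fin N), x ≠ 0 → Real.log ‖x‖ ≤ T₀ → x ∈ Ω \ {0})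
    (ht₁ : t₁ ≤ T₀) (hb₀ : t₁ < b₀) (hc : 0 < c)
    (hcA : c ^ (q - 1) = 2 / (q - 1) + κ * (2 / (q - 1)) ^ 2)
    (hbd : ∀ x : EuclideanSpace ℝ (Fin N), x ≠ 0 → Real.log ‖x‖ = t₁ →
      c ≤ Real.exp (Z x) * (b₀ - t₁) ^ (2 / (q - 1)))
    {x : EuclideanSpace ℝ (Fin N)} (hx : x ≠ 0) (hxt : Real.log ‖x‖ ≤ t₁)
    (hTx : T ≤ Real.log ‖x‖) :
    Real.exp (-Z x) * ((b₀ - Real.log ‖x‖) ^ (-(κ * (2 / (q - 1))))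
      - (b₀ - T) ^ (-(κ * (2 / (q - 1))))) ^ κ⁻¹ ≤ c⁻¹ := by
  have hq1 : 0 < q - 1 := by linarith
  set m := 2 / (q - 1) with hm
  have hmpos : 0 < m := by positivity
  have hmq : m * (q - 1) = 2 := by rw [hm]; field_simp
  set b := κ * m with hb
  have hbpos : 0 < b := by positivity
  have hκ' : 0 < κ⁻¹ := inv_pos.2 hκ
  by_contra! hlt
  have hsub : logAnnulus N T t₁ ⊆ Ω \ {0} := fun y hy => hΩT y hy.1 (hy.2.2.trans ht₁)
  have hxA : x ∈ logAnnulus N T t₁ := ⟨hx, hTx, hxt⟩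
  set y : ℝ → ℝ := fun t => (b₀ - t) ^ (-b) - (b₀ - T) ^ (-b) with hy
  have hyd : ∀ t, t < b₀ → HasDerivAt y (b * (b₀ - t) ^ (-b - 1)) t := fun t ht => by
    have := (hasDerivAt_sub_rpow (-b) ht).sub_const ((b₀ - T) ^ (-b))
    refine this.congr_deriv ?_
    ring
  have hyc : ContinuousOn y (Set.Icc T t₁) := fun t ht =>
    (hyd t (ht.2.trans_lt hb₀)).continuousAt.continuousWithinAt
  obtain ⟨x₀, hx₀, hmax⟩ := (isCompact_logAnnulus T t₁).exists_isMaxOn ⟨x, hxA⟩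
    (continuousOn_exp_mul_rpow hZc (c := -1) hκ' (φ := y) hyc hsub)
  have hmax' : ∀ z ∈ logAnnulus N T t₁, Real.exp (-Z z) * y (Real.log ‖z‖) ^ κ⁻¹
      ≤ Real.exp (-Z x₀) * y (Real.log ‖x₀‖) ^ κ⁻¹ := fun z hz => by simpa using hmax hz
  have hF : c⁻¹ < Real.exp (-Z x₀) * y (Real.log ‖x₀‖) ^ κ⁻¹ := hlt.trans_le (hmax' x hxA)
  have hne2 : Real.log ‖x₀‖ ≠ T := by
    intro he
    have h0 : y (Real.log ‖x₀‖) = 0 := by rw [hy, he]; ring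
    rw [h0, Real.zero_rpow hκ'.ne', mul_zero] at hF
    exact absurd hF (not_lt.2 (inv_pos.2 hc).le)
  set t := Real.log ‖x₀‖ with ht
  have hTt : T < t := lt_of_le_of_ne hx₀.2.1 (Ne.symm hne2)
  have htb : t < b₀ := hx₀.2.2.trans_lt hb₀
  have hbt : 0 < b₀ - t := sub_pos.2 htb
  have hypos : 0 < y t := by
    have := Real.rpow_lt_rpow_of_neg hbt (by linarith : b₀ - t < b₀ - T) (neg_lt_zero.2 hbpos)
    simp only [hy]; linarith
  have hyP : y t ≤ (b₀ - t) ^ (-b) := by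
    have : 0 < (b₀ - T) ^ (-b) := Real.rpow_pos_of_pos (by linarith) _
    simp only [hy]; linarith
  have hne1 : t ≠ t₁ := by
    intro he
    have h1 := hbd x₀ hx₀.1 he
    rw [← he] at h1
    have h2 : y t ^ κ⁻¹ ≤ ((b₀ - t) ^ m)⁻¹ := by
      refine (Real.rpow_le_rpow hypos.le hyP hκ'.le).trans (le_of_eq ?_)
      rw [← Real.rpow_mul hbt.le, ← Real.rpow_neg hbt.le, hb]
      congr 1
      field_simp
    have h3 := mul_le_mul_of_nonneg_left h2 (Real.exp_pos (-Z x₀)).le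
    rw [Real.exp_neg, ← mul_inv] at h3
    rw [Real.exp_neg] at hF
    exact absurd (hF.trans_le h3) (not_lt.2 (inv_anti₀ hc h1))
  have hd2 : HasDerivAt (fun t => b * (b₀ - t) ^ (-b - 1))
      (b * (b + 1) * (b₀ - t) ^ (-b - 2)) t := by
    refine ((hasDerivAt_sub_rpow (-b - 1) htb).const_mul b).congr_deriv ?_
    rw [show -b - 1 - 1 = -b - 2 by ring]
    ring
  have key := hZ.le_exp (hsub hx₀) (y := y) (s := κ⁻¹)
    ((eventually_lt_nhds htb).mono fun t' ht' => hyd t' ht')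
    ((contDiffAt_sub_rpow _ htb).sub contDiffAt_const)
    (contDiffAt_const.mul (contDiffAt_sub_rpow _ htb)) hd2 hypos
    ((eventually_mem_logAnnulus hx₀.1 hTt (lt_of_le_of_ne hx₀.2.2 hne1)).mono hmax')
  rw [← ht] at key
  set y₁ := b * (b₀ - t) ^ (-b - 1) with hy₁
  have hy₁pos : 0 < y₁ := by positivity
  have h1 := hh (κ⁻¹ * (y₁ / y t)) (by positivity)
  have h2 : κ⁻¹ * ((b * (b + 1) * (b₀ - t) ^ (-b - 2) * y t - y₁ * y₁) / y t ^ 2)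
      + κ * (κ⁻¹ * (y₁ / y t)) ^ 2 = κ⁻¹ * (b * (b + 1)) * ((b₀ - t) ^ (-b - 2) / y t) := by
    field_simp
    ring
  have h3 : y t ^ (κ⁻¹ * (q - 1)) ≤ (b₀ - t) ^ (-b - 2) / y t := by
    rw [le_div_iff₀ hypos]
    have h4 : κ⁻¹ * (q - 1) = 2 / b := by
      rw [hb, ← hmq]; field_simp
    have h5 : (b₀ - t) ^ (-b - 2) = ((b₀ - t) ^ (-b)) ^ (2 / b) * (b₀ - t) ^ (-b) := by
      rw [← Real.rpow_mul hbt.le, ← Real.rpow_add hbt]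
      congr 1
      field_simp
      ring
    rw [h4, h5]
    exact mul_le_mul (Real.rpow_le_rpow hypos.le hyP (by positivity)) hyP hypos.le (by positivity)
  have hA : κ⁻¹ * (b * (b + 1)) = c ^ (q - 1) := by
    rw [hcA, hb]; field_simp; ring
  have hcq : 0 < c ^ (q - 1) := by positivity
  have h6 : c ^ (q - 1) * y t ^ (κ⁻¹ * (q - 1)) ≤ Real.exp ((q - 1) * Z x₀) := by
    have := mul_le_mul_of_nonneg_left h3 hcq.le
    rw [← hA] at this ⊢
    linarith
  have h7 : (Real.exp (-Z x₀) * y t ^ κ⁻¹) ^ (q - 1) ≤ c⁻¹ ^ (q - 1) := by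
    rw [Real.mul_rpow (Real.exp_pos _).le (by positivity), ← Real.rpow_mul hypos.le,
      ← Real.exp_mul, Real.inv_rpow hc.le, neg_mul, mul_comm (Z x₀), Real.exp_neg,
      inv_mul_le_iff₀ (Real.exp_pos _), ← div_eq_mul_inv, le_div_iff₀ hcq]
    linarith
  exact absurd hF (not_lt.2 ((Real.rpow_le_rpow_iff (by positivity) (by positivity) hq1).1 h7))

/-- Comparison with `c (b₀ - t) ^ (-2 / (q - 1))` from below. -/
lemma SuperContact.le_mul_rpow (hZ : SuperContact Ω Z q h)
    (hZc : ContinuousOn Z (Ω \ {0})) (hq : 1 < q) {κ T₀ t₁ b₀ c : ℝ} (hκ : 0 < κ)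
    (hh : ∀ p, 0 ≤ p → κ * p ^ 2 ≤ h p)
    (hΩT : ∀ x : EuclideanSpace ℝ (Fin N), x ≠ 0 → Real.log ‖x‖ ≤ T₀ → x ∈ Ω \ {0})
    (ht₁ : t₁ ≤ T₀) (hb₀ : t₁ < b₀) (hc : 0 < c)
    (hcA : c ^ (q - 1) = 2 / (q - 1) + κ * (2 / (q - 1)) ^ 2)
    (hbd : ∀ x : EuclideanSpace ℝ (Fin N), x ≠ 0 → Real.log ‖x‖ = t₁ →
      c ≤ Real.exp (Z x) * (b₀ - t₁) ^ (2 / (q - 1)))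
    {x : EuclideanSpace ℝ (Fin N)} (hx : x ≠ 0) (hxt : Real.log ‖x‖ ≤ t₁) :
    c ≤ Real.exp (Z x) * (b₀ - Real.log ‖x‖) ^ (2 / (q - 1)) := by
  have hmpos : 0 < 2 / (q - 1) := div_pos two_pos (by linarith)
  have hbt : 0 < b₀ - Real.log ‖x‖ := by linarith
  have h1 : Tendsto (fun T : ℝ => b₀ - T) atBot atTop :=
    tendsto_atTop_add_const_left _ b₀ tendsto_neg_atBot_atTop
  have h2 := ((((tendsto_rpow_neg_atTop (mul_pos hκ hmpos)).comp h1).const_sub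
    ((b₀ - Real.log ‖x‖) ^ (-(κ * (2 / (q - 1)))))).rpow_const
    (p := κ⁻¹) (Or.inr (inv_nonneg.2 hκ.le))).const_mul (Real.exp (-Z x))
  have h3 := le_of_tendsto h2 ((eventually_le_atBot (Real.log ‖x‖)).mono fun T hT =>
    hZ.exp_neg_mul_rpow_le hZc hq hκ hh hΩT ht₁ hb₀ hc hcA hbd hx hxt hT)
  rw [sub_zero, ← Real.rpow_mul hbt.le, neg_mul, mul_comm κ, mul_assoc, mul_inv_cancel₀ hκ.ne',
    mul_one, Real.rpow_neg hbt.le, Real.exp_neg, ← mul_inv] at h3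
  exact (inv_le_inv₀ (by positivity) hc).1 h3

/-- Sharp asymptotic lower bound. -/
lemma SuperContact.eventually_gt (hZ : SuperContact Ω Z q h)
    (hZc : ContinuousOn Z (Ω \ {0})) (hq : 1 < q) {κ T₀ D : ℝ} (hκ : 0 < κ)
    (hh : ∀ p, 0 ≤ p → κ * p ^ 2 ≤ h p)
    (hΩT : ∀ x : EuclideanSpace ℝ (Fin N), x ≠ 0 → Real.log ‖x‖ ≤ T₀ → x ∈ Ω \ {0})
    (hD : D < (2 / (q - 1) + κ * (2 / (q - 1)) ^ 2) ^ (1 / (q - 1))) :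
    ∃ t₀ < 0, ∀ x : EuclideanSpace ℝ (Fin N), x ≠ 0 → Real.log ‖x‖ ≤ t₀ →
      D < Real.exp (Z x) * (-Real.log ‖x‖) ^ (2 / (q - 1)) := by
  have hq1 : 0 < q - 1 := by linarith
  set m := 2 / (q - 1) with hm
  have hmpos : 0 < m := by positivity
  set A := m + κ * m ^ 2 with hA
  have hApos : 0 < A := by positivity
  set c := A ^ (1 / (q - 1)) with hc
  have hcpos : 0 < c := by positivity
  have hcA : c ^ (q - 1) = A := by
    rw [hc, ← Real.rpow_mul hApos.le, one_div_mul_cancel hq1.ne', Real.rpow_one]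
  obtain ⟨B, hB⟩ := (isCompact_logAnnulus (N := N) T₀ T₀).bddBelow_image
    (hZc.mono fun y hy => hΩT y hy.1 hy.2.2)
  have hlim : Tendsto (fun b₀ : ℝ => Real.exp B * (b₀ - T₀) ^ m) atTop atTop :=
    ((tendsto_rpow_atTop hmpos).comp (tendsto_atTop_add_const_right _ (-T₀)
      tendsto_id)).const_mul_atTop (Real.exp_pos B)
  obtain ⟨b₀, hb₀c, hb₀⟩ := ((hlim.eventually_ge_atTop c).and (eventually_gt_atTop T₀)).exists
  have hbd : ∀ x : EuclideanSpace ℝ (Fin N), x ≠ 0 → Real.log ‖x‖ = T₀ →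
      c ≤ Real.exp (Z x) * (b₀ - T₀) ^ m := by
    intro x hx hxt
    refine hb₀c.trans (mul_le_mul_of_nonneg_right (Real.exp_le_exp.2 ?_)
      (Real.rpow_nonneg (by linarith) _))
    exact hB ⟨x, ⟨hx, hxt.ge, hxt.le⟩, rfl⟩
  have hr : Tendsto (fun t : ℝ => c * (-t / (b₀ - t)) ^ m) atBot (𝓝 c) := by
    simpa using (tendsto_ratio_rpow b₀ m).const_mul c
  obtain ⟨t₀, ht₀⟩ := ((hr.eventually_const_lt hD).and
    ((eventually_lt_atBot 0).and (eventually_le_atBot T₀))).exists_forall_of_atBot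
  refine ⟨t₀, (ht₀ t₀ le_rfl).2.1, fun x hx hxt => ?_⟩
  obtain ⟨h1, h2, h3⟩ := ht₀ _ hxt
  refine lt_of_lt_of_le h1 ?_
  have h4 := hZ.le_mul_rpow hZc hq hκ hh hΩT le_rfl hb₀ hcpos hcA hbd hx h3
  have h5 : 0 < b₀ - Real.log ‖x‖ := by linarith
  rw [Real.div_rpow (by linarith) h5.le, mul_div_assoc', div_le_iff₀ (by positivity)]
  have h6 := mul_le_mul_of_nonneg_right h4 (Real.rpow_nonneg (by linarith : 0 ≤ -Real.log ‖x‖) m)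
  linarith

end Asymptotics

lemma continuousOn_relLog {N : ℕ} {Ω : Set (EuclideanSpace ℝ (Fin N))}
    {u : EuclideanSpace ℝ (Fin N) → ℝ} (w : ℝ) (hu : PosC1 Ω u) :
    ContinuousOn (relLog w u) (Ω \ {0}) :=
  (hu.1.continuousOn.log fun x hx => (hu.2 x hx).ne').sub (continuousOn_const.mul
    fun _ hx => (continuousAt_log_norm hx.2).continuousWithinAt)

lemma exists_forall_log_norm_le_mem {N : ℕ} {Ω : Set (EuclideanSpace ℝ (Fin N))}
    (hΩ : IsOpen Ω) (h0 : (0 : EuclideanSpace ℝ (Fin N)) ∈ Ω) :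
    ∃ T₀ < 0, ∀ x : EuclideanSpace ℝ (Fin N), x ≠ 0 → Real.log ‖x‖ ≤ T₀ → x ∈ Ω \ {0} := by
  obtain ⟨r, hr, hball⟩ := Metric.isOpen_iff.1 hΩ 0 h0
  refine ⟨min (-1) (Real.log r - 1), by simp, fun x hx hxt => ⟨hball ?_, hx⟩⟩
  rw [mem_ball_zero_iff, ← Real.log_lt_log_iff (norm_pos_iff.2 hx) hr]
  linarith [hxt.trans (min_le_right _ _)]

/-- In Case [N₂] with `ρ = Υ` and `β = ϖ₁ = ϖ₂ = -(λτ)^{1/(τ+1)}`, every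
positive solution `u` of (E) in `Ω \ {0}` satisfies
`|x|^{ϖ₁} |log|x||^{2/(q-1)} u(x) → (2(q+τ)/(q-1)²)^{1/(q-1)}` as `|x| → 0`. -/
theorem stmt12_critical_beta_rho_Upsilon
    (N : ℕ) (hN : 2 ≤ N) (ρ lam τ θ q : ℝ)
    (hτ0 : 0 ≤ τ) (hτ1 : τ < 1) (hq : 1 < q)
    (Ω : Set (EuclideanSpace ℝ (Fin N))) (hΩ : IsOpen Ω) (h0 : (0 : EuclideanSpace ℝ (Fin N)) ∈ Ω)
    (hcase : CaseN2 ρ lam τ) (hρ : ρ = Upsilon lam τ)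
    (hβ : (θ + 2) / (q - 1) = -((lam * τ) ^ (1 / (τ + 1))))
    (u : EuclideanSpace ℝ (Fin N) → ℝ)
    (hu : IsSolutionE N ρ lam τ θ q Ω u) :
    Filter.Tendsto (fun x : EuclideanSpace ℝ (Fin N) =>
        ‖x‖ ^ (-((lam * τ) ^ (1 / (τ + 1)))) * |Real.log ‖x‖| ^ (2 / (q - 1)) * u x)
      (𝓝[≠] (0 : EuclideanSpace ℝ (Fin N)))
      (𝓝 ((2 * (q + τ) / (q - 1) ^ 2) ^ (1 / (q - 1)))) := by
  obtain ⟨hlam0, hτ, -, -⟩ := hcase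
  have hq1 : 0 < q - 1 := by linarith
  set w := (lam * τ) ^ (1 / (τ + 1)) with hw_def
  have hlτ : 0 < lam * τ := mul_pos hlam0 hτ
  have hw : 0 < w := by positivity
  have hlam : w ^ (τ + 1) = lam * τ := by
    rw [hw_def, ← Real.rpow_mul hlτ.le, one_div_mul_cancel (by linarith), Real.rpow_one]
  have hρ' : ρ = (τ + 1) / (2 * τ) * w := hρ
  have hθ : θ + 2 = -w * (q - 1) := (div_eq_iff hq1.ne').1 hβ
  obtain ⟨T₀, hT₀, hΩT⟩ := exists_forall_log_norm_le_mem hΩ h0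
  have hZc := continuousOn_relLog w hu.1
  have hsub : SubContact Ω (relLog w u) q (hFun w ρ lam τ) :=
    fun x₀ hx₀ z z₁ z₂ hz hzc hz₁c hz₁ hmax =>
      exp_relLog_le_of_isLocalMax hΩ hτ1 hu hθ hx₀ hz hzc hz₁c hz₁ hmax
  have hsuper : SuperContact Ω (relLog w u) q (hFun w ρ lam τ) :=
    fun x₀ hx₀ z z₁ z₂ hz hzc hz₁c hz₁ hmin =>
      le_exp_relLog_of_isLocalMin hΩ hτ1 hu hθ hx₀ hz hzc hz₁c hz₁ hmin
  have hA : 2 * (q + τ) / (q - 1) ^ 2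
      = 2 / (q - 1) + (1 + τ) / 2 * (2 / (q - 1)) ^ 2 := by
    field_simp
    ring
  have hlog : Tendsto (fun x : EuclideanSpace ℝ (Fin N) => Real.log ‖x‖) (𝓝[≠] 0) atBot :=
    Real.tendsto_log_nhdsGT_zero.comp tendsto_norm_nhdsNE_zero
  have hL : 0 ≤ (1 - τ) * (τ + 1) / (6 * w) :=
    div_nonneg (mul_nonneg (by linarith) (by linarith)) (by linarith)
  have hlim : Tendsto (fun x => Real.exp (relLog w u x) * (-Real.log ‖x‖) ^ (2 / (q - 1)))
      (𝓝[≠] 0) (𝓝 ((2 * (q + τ) / (q - 1) ^ 2) ^ (1 / (q - 1)))) := by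
    rw [hA, tendsto_order]
    constructor
    · intro D hD
      obtain ⟨t₀, -, ht₀⟩ := hsuper.eventually_gt hZc hq (by linarith)
        (fun p hp => quadratic_le_hFun hw hτ hτ1 hlam hρ' hp) hΩT hD
      filter_upwards [hlog.eventually_le_atBot t₀, self_mem_nhdsWithin] with x h1 h2
      exact ht₀ x h2 h1
    · intro D hD
      obtain ⟨t₀, -, ht₀⟩ := hsub.eventually_lt hZc hq (by positivity) (by linarith) hL
        (fun p => hFun_le_quadratic hw hτ hτ1 hlam hρ' p)
        (fun p hp => hFun_le_cubic hw hτ hτ1 hlam hρ' hp) hT₀ hΩT hD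
      filter_upwards [hlog.eventually_le_atBot t₀, self_mem_nhdsWithin] with x h1 h2
      exact ht₀ x h2 h1
  refine hlim.congr' ?_
  filter_upwards [hlog.eventually_le_atBot T₀, self_mem_nhdsWithin] with x h1 h2
  have hxp : 0 < ‖x‖ := norm_pos_iff.2 h2
  rw [relLog, sub_eq_add_neg, Real.exp_add, Real.exp_log (hu.1.2 x (hΩT x h2 h1)),
    abs_of_neg (h1.trans_lt hT₀), Real.rpow_def_of_pos hxp,
    show -(w * Real.log ‖x‖) = Real.log ‖x‖ * -w by ring]
  ring

end
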